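/- Let V be a nonzero finite-dimensional irreducible representation of g, and suppose ψ ∈ h* is a highest weight of V, i.e. there exists a nonzero vector v in the weight space V_ψ such that x·v = 0 for every x lying in a root space g_α with α ∈ Φ⁺. Then in the group algebra ℤ[h*] one has ch(V) · Σ_{w∈W} (−1)^{ℓ(w)} e(w(ρ)) = Σ_{w∈W} (−1)^{ℓ(w)} e(w(ψ+ρ)) (the Weyl character formula). -/

import Mathlib

set_option linter.unusedSectionVars false

open LieAlgebra LieModule

/-- The length of `w` with respect to a generating set `S` of a group: the minimal length of a
word in the elements of `S` with product `w`. -/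
noncomputable def wordLength {G : Type*} [Group G] (S : Set G) (w : G) : ℕ :=
  sInf {n | ∃ l : List G, (∀ s ∈ l, s ∈ S) ∧ l.prod = w ∧ l.length = n}

namespace WCF

/-- Auxiliary packaging: a reduced crystallographic root system in a `k`-vector space `E`, with an
invariant form that is positive rational on the root lattice, and a positive system. -/
structure PosRS (k E : Type*) [Field k] [CharZero k] [AddCommGroup E] [Module k E] where
  Φ : Finset E
  Φp : Finset E
  B : E →ₗ[k] E →ₗ[k] k
  c : E → E →ₗ[k] k
  symm : ∀ x y, B x y = B y x
  B_pos : ∀ α ∈ Φ, ∃ q : ℚ, 0 < q ∧ B α α = q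
  B_c : ∀ α ∈ Φ, ∀ x, 2 * B α x = c α x * B α α
  int : ∀ α ∈ Φ, ∀ β ∈ Φ, ∃ n : ℤ, c α β = n
  c_self : ∀ α ∈ Φ, c α α = 2
  refl : ∀ α ∈ Φ, ∀ β ∈ Φ, β - c α β • α ∈ Φ
  definite : ∀ x ∈ AddSubgroup.closure (Φ : Set E), x ≠ 0 → ∃ q : ℚ, 0 < q ∧ B x x = q
  reduced : ∀ α ∈ Φ, ∀ t : k, t • α ∈ Φ → t = 1 ∨ t = -1
  string : ∀ α ∈ Φ, ∀ β ∈ Φ, ∀ n : ℤ, c α β = n → n < 0 → α ≠ -β → α + β ∈ Φ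
  sub : Φp ⊆ Φ
  neg_iff : ∀ α ∈ Φ, (α ∈ Φp ↔ ¬(-α ∈ Φp))
  closed : ∀ α ∈ Φp, ∀ β ∈ Φp, α + β ∈ Φ → α + β ∈ Φp

namespace PosRS

variable {k E : Type*} [Field k] [CharZero k] [AddCommGroup E] [Module k E] (P : PosRS k E)

def Simple (α : E) : Prop := α ∈ P.Φp ∧ ¬ ∃ β ∈ P.Φp, ∃ γ ∈ P.Φp, α = β + γ

def C : AddSubmonoid E := AddSubmonoid.closure (P.Φp : Set E)

lemma ne_zero {α : E} (h : α ∈ P.Φ) : α ≠ 0 := by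
  rintro rfl
  have := P.c_self 0 h
  simp at this

lemma neg_mem {α : E} (h : α ∈ P.Φ) : -α ∈ P.Φ := by
  have := P.refl α h α h
  rw [P.c_self α h] at this
  convert this using 1
  module

lemma mem_or {α : E} (h : α ∈ P.Φ) : α ∈ P.Φp ∨ -α ∈ P.Φp := by
  have := P.neg_iff α h
  tauto

lemma not_neg {α : E} (h : α ∈ P.Φp) : -α ∉ P.Φp := (P.neg_iff α (P.sub h)).1 h

lemma mem_C {α : E} (h : α ∈ P.Φp) : α ∈ P.C := AddSubmonoid.subset_closure h

lemma B_rat {α : E} (hα : α ∈ P.Φ) {x : E} {n : ℤ} (h : P.c α x = n) :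
    ∃ q : ℚ, 0 < q ∧ P.B α x = (n * q : ℚ) := by
  obtain ⟨q, hq, h2⟩ := P.B_pos α hα
  refine ⟨q / 2, by positivity, ?_⟩
  have := P.B_c α hα x
  rw [h, h2] at this
  push_cast
  linear_combination this / 2

lemma B_nonneg {α : E} (hα : α ∈ P.Φ) {x : E} {n : ℤ} (h : P.c α x = n) (hn : 0 ≤ n) :
    ∃ q : ℚ, 0 ≤ q ∧ P.B α x = q := by
  obtain ⟨q, hq, h2⟩ := P.B_rat hα h
  have : (0 : ℚ) ≤ n := by exact_mod_cast hn
  exact ⟨_, by positivity, h2⟩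

lemma B_posval {α : E} (hα : α ∈ P.Φ) {x : E} {n : ℤ} (h : P.c α x = n) (hn : 0 < n) :
    ∃ q : ℚ, 0 < q ∧ P.B α x = q := by
  obtain ⟨q, hq, h2⟩ := P.B_rat hα h
  have : (0 : ℚ) < n := by exact_mod_cast hn
  exact ⟨_, by positivity, h2⟩

/-- A sum of nonnegative rationals is a nonnegative rational. -/
lemma multiset_nonneg (f : E →ₗ[k] k) (s : Multiset E)
    (h : ∀ x ∈ s, ∃ q : ℚ, 0 ≤ q ∧ f x = q) : ∃ q : ℚ, 0 ≤ q ∧ f s.sum = q := by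
  induction s using Multiset.induction_on with
  | empty => exact ⟨0, le_rfl, by simp⟩
  | cons a s ih =>
    obtain ⟨q, hq, h1⟩ := ih fun x hx => h x (Multiset.mem_cons_of_mem hx)
    obtain ⟨r, hr, h2⟩ := h a (Multiset.mem_cons_self a s)
    exact ⟨r + q, by positivity, by simp [h1, h2]⟩

lemma add_mem_of_neg {α β : E} (hα : α ∈ P.Φp) (hβ : β ∈ P.Φp) {n : ℤ} (h : P.c α β = n)
    (hn : n < 0) : α + β ∈ P.Φp := by
  refine P.closed α hα β hβ (P.string α (P.sub hα) β (P.sub hβ) n h hn ?_)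
  rintro rfl
  exact P.not_neg hβ hα

lemma sum_eq_zero_aux (n : ℕ) : ∀ s : Multiset E, s.card = n → (∀ x ∈ s, x ∈ P.Φp) →
    s.sum = 0 → s = 0 := by
  classical
  induction n with
  | zero => intro s hs _ _; exact Multiset.card_eq_zero.1 hs
  | succ n ih =>
    intro s hs hp h0
    obtain ⟨α, hα⟩ := Multiset.card_pos_iff_exists_mem.1 (by omega : 0 < s.card)
    obtain ⟨s', rfl⟩ := Multiset.exists_cons_of_mem hα
    have hαp := hp α hα
    by_cases hc : ∃ β ∈ s', ∃ n : ℤ, P.c α β = n ∧ n < 0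
    · obtain ⟨β, hβ, m, hm, hm0⟩ := hc
      obtain ⟨t, rfl⟩ := Multiset.exists_cons_of_mem hβ
      have hβp := hp β (by simp)
      have := ih ((α + β) ::ₘ t) (by simpa using hs) (by
        intro x hx
        rcases Multiset.mem_cons.1 hx with rfl | hx
        · exact P.add_mem_of_neg hαp hβp hm hm0
        · exact hp x (by simp [hx])) (by simpa [add_assoc] using h0)
      simp at this
    · exfalso
      push Not at hc
      obtain ⟨q, hq, h1⟩ := multiset_nonneg (P.B α) s' (by
        intro β hβ
        obtain ⟨m, hm⟩ := P.int α (P.sub hαp) β (P.sub (hp β (by simp [hβ])))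
        exact P.B_nonneg (P.sub hαp) hm (hc β hβ m hm))
      obtain ⟨r, hr, h2⟩ := P.B_pos α (P.sub hαp)
      have h3 : P.B α (α ::ₘ s').sum = 0 := by rw [h0]; simp
      rw [Multiset.sum_cons, map_add, h1, h2] at h3
      have : r + q = 0 := by exact_mod_cast h3
      linarith

lemma sum_eq_zero {s : Multiset E} (h : ∀ x ∈ s, x ∈ P.Φp) (h0 : s.sum = 0) : s = 0 :=
  P.sum_eq_zero_aux _ s rfl h h0

lemma C_pointed {x : E} (h : x ∈ P.C) (h' : -x ∈ P.C) : x = 0 := by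
  obtain ⟨s, hs, rfl⟩ := AddSubmonoid.exists_multiset_of_mem_closure h
  obtain ⟨t, ht, h2⟩ := AddSubmonoid.exists_multiset_of_mem_closure h'
  have := P.sum_eq_zero (s := s + t) (by
    intro x hx
    rcases Multiset.mem_add.1 hx with hx | hx
    · exact hs x hx
    · exact ht x hx) (by simp [h2])
  have : s = 0 := by
    have := congrArg Multiset.card this
    simp at this
    tauto
  simp [this]

lemma pos_not_negC {α : E} (h : α ∈ P.Φp) : -α ∉ P.C := fun hneg =>
  P.ne_zero (P.sub h) (P.C_pointed (P.mem_C h) hneg)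

/-- The partial order attached to the positive cone. -/
@[reducible] def order : PartialOrder E where
  le x y := y - x ∈ P.C
  le_refl x := by simp
  le_trans x y z h1 h2 := by
    have := P.C.add_mem h1 h2
    simpa using this
  le_antisymm x y h1 h2 := by
    have := P.C_pointed h1 (by simpa using h2)
    exact (sub_eq_zero.1 this).symm

lemma exists_max (s : Finset E) (hs : s.Nonempty) : ∃ m ∈ s, ∀ y ∈ s, y - m ∈ P.C → y = m := by
  letI := P.order
  obtain ⟨m, hm⟩ := s.exists_maximal hs
  exact ⟨m, hm.1, fun y hy h => (hm.eq_of_le hy h).symm⟩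

lemma exists_min (s : Finset E) (hs : s.Nonempty) : ∃ m ∈ s, ∀ y ∈ s, m - y ∈ P.C → y = m := by
  letI := P.order
  obtain ⟨m, hm⟩ := s.exists_minimal hs
  exact ⟨m, hm.1, fun y hy h => (hm.eq_of_ge hy h).symm⟩

/-- Every positive root is a sum of simple roots. -/
lemma pos_mem_closure_simple {α : E} (h : α ∈ P.Φp) :
    α ∈ AddSubmonoid.closure {β | P.Simple β} := by
  classical
  by_contra hα
  obtain ⟨m, hm, hmin⟩ := P.exists_min
    (P.Φp.filter (fun α => α ∉ AddSubmonoid.closure {β | P.Simple β}))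
    ⟨α, by simp [h, hα]⟩
  rw [Finset.mem_filter] at hm
  by_cases hs : P.Simple m
  · exact hm.2 (AddSubmonoid.subset_closure hs)
  · have : ∃ β ∈ P.Φp, ∃ γ ∈ P.Φp, m = β + γ := by
      by_contra h'
      exact hs ⟨hm.1, h'⟩
    obtain ⟨β, hβ, γ, hγ, rfl⟩ := this
    apply hm.2
    refine AddSubmonoid.add_mem _ ?_ ?_
    · by_contra h'
      have := hmin β (by simp [hβ, h']) (by simpa using P.mem_C hγ)
      exact P.ne_zero (P.sub hγ) (by simpa using this)
    · by_contra h'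
      have := hmin γ (by simp [hγ, h']) (by simpa using P.mem_C hβ)
      exact P.ne_zero (P.sub hβ) (by simpa using this)

lemma C_eq : P.C = AddSubmonoid.closure {β | P.Simple β} := by
  apply le_antisymm
  · exact AddSubmonoid.closure_le.2 fun x hx => P.pos_mem_closure_simple hx
  · exact AddSubmonoid.closure_mono fun x hx => hx.1

lemma exists_simple_multiset {x : E} (h : x ∈ P.C) :
    ∃ s : Multiset E, (∀ y ∈ s, P.Simple y) ∧ s.sum = x := by
  rw [C_eq] at h
  exact AddSubmonoid.exists_multiset_of_mem_closure h

lemma sub_simple {α β : E} (hα : P.Simple α) (hβ : β ∈ P.Φp) (hne : β ≠ α) {n : ℤ}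
    (h : P.c α β = n) (hn : 0 < n) : β - α ∈ P.Φp := by
  have h1 : α + -β ∈ P.Φ := P.string α (P.sub hα.1) (-β) (P.neg_mem (P.sub hβ)) (-n)
    (by simp [h]) (by omega) (by simpa using hne.symm)
  rcases P.mem_or h1 with h2 | h2
  · exact absurd ⟨_, h2, β, hβ, by simp⟩ hα.2
  · convert h2 using 1; abel

lemma simple_aux {α : E} (hα : P.Simple α) (n : ℕ) : ∀ β ∈ P.Φp, ∀ γ ∈ P.Φp, β ≠ α →
    (n : k) • α ≠ β + γ := by
  induction n with
  | zero =>
    intro β hβ γ hγ _ h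
    simp only [Nat.cast_zero, zero_smul] at h
    have : γ = -β := by rw [eq_neg_iff_add_eq_zero, add_comm]; exact h.symm
    exact P.not_neg hβ (this ▸ hγ)
  | succ n ih =>
    intro β hβ γ hγ hne h
    obtain ⟨b, hb⟩ := P.int α (P.sub hα.1) β (P.sub hβ)
    obtain ⟨g, hg⟩ := P.int α (P.sub hα.1) γ (P.sub hγ)
    have h1 := congrArg (P.c α) h
    rw [map_add, hb, hg, map_smul, P.c_self α (P.sub hα.1), smul_eq_mul] at h1
    have h2 : ((n : ℤ) + 1) * 2 = b + g := by exact_mod_cast h1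
    by_cases hb0 : 0 < b
    · have h3 := P.sub_simple hα hβ hne hb hb0
      refine ih _ h3 γ hγ ?_ ?_
      · intro h4
        have : β = (2 : k) • α := by rw [sub_eq_iff_eq_add] at h4; rw [h4]; module
        rcases P.reduced α (P.sub hα.1) 2 (this ▸ P.sub hβ) with h5 | h5
        · norm_num at h5
        · have : (3 : k) = 0 := by linear_combination h5
          norm_num at this
      · have : (n : k) • α = ((n + 1 : ℕ) : k) • α - α := by push_cast; module
        rw [this, h]; abel
    · have hg0 : 0 < g := by omega
      by_cases hγα : γ = α
      · subst hγα
        have h3 : β = (n : k) • γ := by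
          rw [← sub_eq_iff_eq_add] at h
          rw [← h]; push_cast; module
        rcases P.reduced γ (P.sub hα.1) n (h3 ▸ P.sub hβ) with h5 | h5
        · exact hne (by rw [h3, h5, one_smul])
        · have : ((n + 1 : ℕ) : k) = 0 := by push_cast; linear_combination h5
          exact Nat.cast_ne_zero.2 (by omega) this
      · have h3 := P.sub_simple hα hγ hγα hg hg0
        refine ih β hβ _ h3 hne ?_
        have : (n : k) • α = ((n + 1 : ℕ) : k) • α - α := by push_cast; module
        rw [this, h]; abel

/-- A simple reflection preserves positivity of roots other than its own. -/
lemma simple_refl_pos {α β : E} (hα : P.Simple α) (hβ : β ∈ P.Φp) (hne : β ≠ α) :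
    β - P.c α β • α ∈ P.Φp := by
  have h1 := P.refl α (P.sub hα.1) β (P.sub hβ)
  rcases P.mem_or h1 with h2 | h2
  · exact h2
  exfalso
  obtain ⟨b, hb⟩ := P.int α (P.sub hα.1) β (P.sub hβ)
  rw [hb] at h2
  rcases le_or_gt 0 b with h0 | h0
  · lift b to ℕ using h0
    refine P.simple_aux hα b β hβ _ h2 hne ?_
    simp
  · obtain ⟨m, rfl⟩ : ∃ m : ℕ, b = -m := ⟨b.natAbs, by omega⟩
    have h3 : -(-(β - ((-m : ℤ) : k) • α)) ∈ P.C := by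
      have : -(-(β - ((-m : ℤ) : k) • α)) = β + m • α := by
        rw [neg_neg, ← Nat.cast_smul_eq_nsmul k]; push_cast; module
      rw [this]
      exact P.C.add_mem (P.mem_C hβ) (P.C.nsmul_mem (P.mem_C hα.1) m)
    exact P.pos_not_negC h2 h3

/-- `g` is the reflection in `α`. -/
def IsRefl (g : E ≃ₗ[k] E) (α : E) : Prop := ∀ y, g y = y - P.c α y • α

def rho : E := (2 : k)⁻¹ • ∑ α ∈ P.Φp, α

lemma refl_sq {α : E} (hα : α ∈ P.Φ) {g : E ≃ₗ[k] E} (hg : P.IsRefl g α) : g * g = 1 := by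
  ext y
  simp only [LinearEquiv.mul_apply, hg y, map_sub, map_smul, hg α, P.c_self α hα,
    LinearEquiv.coe_one, id]
  module

lemma refl_inv {α : E} (hα : α ∈ P.Φ) {g : E ≃ₗ[k] E} (hg : P.IsRefl g α) : g⁻¹ = g :=
  inv_eq_of_mul_eq_one_right (P.refl_sq hα hg)

lemma refl_ext {α : E} {g g' : E ≃ₗ[k] E} (hg : P.IsRefl g α) (hg' : P.IsRefl g' α) : g = g' := by
  ext y; rw [hg, hg']

lemma exists_refl {α : E} (hα : α ∈ P.Φ) : ∃ g : E ≃ₗ[k] E, P.IsRefl g α :=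
  ⟨Module.reflection (P.c_self α hα), fun y => by simp [Module.reflection_apply]⟩

/-- A simple reflection permutes the other positive roots. -/
lemma simple_image [DecidableEq E] {α : E} (hα : P.Simple α) {g : E ≃ₗ[k] E}
    (hg : P.IsRefl g α) : (P.Φp.erase α).image g = P.Φp.erase α := by
  have key : ∀ β ∈ P.Φp.erase α, g β ∈ P.Φp.erase α := by
    intro β hβ
    rw [Finset.mem_erase] at hβ ⊢
    refine ⟨?_, ?_⟩
    · intro h
      have h2 : g (g β) = g α := by rw [h]
      have h3 : g (g β) = β := LinearEquiv.congr_fun (P.refl_sq (P.sub hα.1) hg) β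
      rw [h3, hg α, P.c_self α (P.sub hα.1)] at h2
      have : β = -α := by rw [h2]; module
      exact P.not_neg hα.1 (this ▸ hβ.2)
    · rw [hg]; exact P.simple_refl_pos hα hβ.2 hβ.1
  apply Finset.eq_of_subset_of_card_le
  · intro x hx
    obtain ⟨β, hβ, rfl⟩ := Finset.mem_image.1 hx
    exact key β hβ
  · rw [Finset.card_image_of_injective _ g.injective]

lemma refl_rho {α : E} (hα : P.Simple α) {g : E ≃ₗ[k] E}
    (hg : P.IsRefl g α) : g P.rho = P.rho - α := by
  classical
  have h1 : ∑ β ∈ P.Φp, β = α + ∑ β ∈ P.Φp.erase α, β := (Finset.add_sum_erase _ _ hα.1).symm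
  have h2 : ∑ β ∈ P.Φp.erase α, g β = ∑ β ∈ P.Φp.erase α, β := by
    conv_rhs => rw [← P.simple_image hα hg]
    rw [Finset.sum_image (fun x _ y _ h => g.injective h)]
  unfold rho
  rw [h1, map_smul, map_add, map_sum, h2, hg α, P.c_self α (P.sub hα.1)]
  match_scalars <;> norm_num

lemma c_rho {α : E} (hα : P.Simple α) : P.c α P.rho = 1 := by
  obtain ⟨g, hg⟩ := P.exists_refl (P.sub hα.1)
  have h := P.refl_rho hα hg
  rw [hg] at h
  have h1 : (P.c α P.rho - 1) • α = 0 := by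
    have : P.c α P.rho • α = α := by
      have := sub_right_injective h
      exact this
    rw [sub_smul, this]; simp
  rcases smul_eq_zero.1 h1 with h | h
  · linear_combination h
  · exact absurd h (P.ne_zero (P.sub hα.1))

lemma refl_B {α : E} (hα : α ∈ P.Φ) {g : E ≃ₗ[k] E} (hg : P.IsRefl g α) (x y : E) :
    P.B (g x) (g y) = P.B x y := by
  rw [hg, hg]
  have h1 := P.B_c α hα x
  have h2 := P.B_c α hα y
  have h3 := P.symm x α
  simp only [map_sub, map_smul, LinearMap.sub_apply, LinearMap.smul_apply, smul_eq_mul, h3]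
  linear_combination (-1/2 * P.c α x) * h2 + (-1/2 * P.c α y) * h1

end PosRS
end WCF

namespace WCF
namespace PosRS

variable {k E : Type*} [Field k] [CharZero k] [AddCommGroup E] [Module k E] (P : PosRS k E)

def SR : Set (E ≃ₗ[k] E) := {g | ∃ α, P.Simple α ∧ P.IsRefl g α}

lemma mem_closure_of_C {x : E} (h : x ∈ P.C) : x ∈ AddSubgroup.closure (P.Φ : Set E) := by
  have : P.C ≤ (AddSubgroup.closure (P.Φ : Set E)).toAddSubmonoid :=
    AddSubmonoid.closure_le.2 fun y hy => AddSubgroup.subset_closure (P.sub hy)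
  exact this h

lemma int_C {α : E} (hα : α ∈ P.Φ) {x : E} (h : x ∈ P.C) : ∃ n : ℤ, P.c α x = n := by
  induction h using AddSubmonoid.closure_induction with
  | mem y hy => exact P.int α hα y (P.sub hy)
  | zero => exact ⟨0, by simp⟩
  | add y z _ _ hy hz =>
    obtain ⟨a, ha⟩ := hy
    obtain ⟨b, hb⟩ := hz
    exact ⟨a + b, by simp [ha, hb]⟩

/-- An element of the cone pairing nonpositively with all simple coroots vanishes. -/
lemma eq_zero_of_nonpos {x : E} (hx : x ∈ P.C)
    (h : ∀ α, P.Simple α → ∀ n : ℤ, P.c α x = n → n ≤ 0) : x = 0 := by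
  by_contra h0
  obtain ⟨q, hq, h1⟩ := P.definite x (P.mem_closure_of_C hx) h0
  obtain ⟨s, hs, hsx⟩ := P.exists_simple_multiset hx
  obtain ⟨r, hr, h2⟩ := multiset_nonneg (-(P.B x)) s (by
    intro β hβ
    obtain ⟨n, hn⟩ := P.int_C (P.sub (hs β hβ).1) hx
    obtain ⟨q, hq, h3⟩ := P.B_rat (P.sub (hs β hβ).1) hn
    have h4 := h β (hs β hβ) n hn
    have h5 : (0 : ℚ) ≤ -n := by exact_mod_cast (by omega : (0 : ℤ) ≤ -n)
    refine ⟨-n * q, by positivity, ?_⟩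
    rw [LinearMap.neg_apply, P.symm, h3]; push_cast; ring)
  rw [hsx, LinearMap.neg_apply, h1] at h2
  have : -q = r := by exact_mod_cast h2
  linarith

lemma exists_simple_pos {β : E} (hβ : β ∈ P.Φp) :
    ∃ α, P.Simple α ∧ ∃ n : ℤ, P.c α β = n ∧ 0 < n := by
  by_contra h
  push Not at h
  exact P.ne_zero (P.sub hβ) (P.eq_zero_of_nonpos (P.mem_C hβ) fun α hα n hn => h α hα n hn)

lemma exists_conj {β : E} (hβ : β ∈ P.Φp) :
    ∃ w ∈ Subgroup.closure P.SR, ∃ α, P.Simple α ∧ w α = β := by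
  classical
  by_contra hcon
  obtain ⟨m, hm, hmin⟩ := P.exists_min
    (P.Φp.filter (fun β => ¬ ∃ w ∈ Subgroup.closure P.SR, ∃ α, P.Simple α ∧ w α = β))
    ⟨β, by simp only [Finset.mem_filter]; exact ⟨hβ, hcon⟩⟩
  rw [Finset.mem_filter] at hm
  obtain ⟨hmp, hm⟩ := hm
  obtain ⟨α, hα, n, hn, hn0⟩ := P.exists_simple_pos hmp
  by_cases hne : m = α
  · subst hne
    exact hm ⟨1, Subgroup.one_mem _, m, hα, rfl⟩
  obtain ⟨g, hg⟩ := P.exists_refl (P.sub hα.1)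
  have hp : g m ∈ P.Φp := by rw [hg]; exact P.simple_refl_pos hα hmp hne
  have hgS : g ∈ Subgroup.closure P.SR := Subgroup.subset_closure ⟨α, hα, hg⟩
  by_cases hc : ∃ w ∈ Subgroup.closure P.SR, ∃ α, P.Simple α ∧ w α = g m
  · obtain ⟨w, hw, γ, hγ, h⟩ := hc
    refine hm ⟨g * w, Subgroup.mul_mem _ hgS hw, γ, hγ, ?_⟩
    rw [LinearEquiv.mul_apply, h]
    exact LinearEquiv.congr_fun (P.refl_sq (P.sub hα.1) hg) m
  · have h1 := hmin (g m) (by simp only [Finset.mem_filter]; exact ⟨hp, hc⟩) (by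
      rw [hg, hn]
      lift n to ℕ using hn0.le
      have : m - (m - ((n : ℤ) : k) • α) = n • α := by
        rw [← Nat.cast_smul_eq_nsmul k]; push_cast; module
      rw [this]
      exact P.C.nsmul_mem (P.mem_C hα.1) n)
    rw [hg, hn, sub_eq_self, smul_eq_zero] at h1
    rcases h1 with h1 | h1
    · have : n = 0 := by exact_mod_cast h1
      omega
    · exact P.ne_zero (P.sub hα.1) h1

/-- The properties shared by the elements of the Weyl group. -/
def Good (w : E ≃ₗ[k] E) : Prop := (∀ x y, P.B (w x) (w y) = P.B x y) ∧ ∀ α ∈ P.Φ, w α ∈ P.Φ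

lemma good_of_mem {w : E ≃ₗ[k] E}
    (h : w ∈ Subgroup.closure {g | ∃ α ∈ P.Φ, P.IsRefl g α}) : P.Good w := by
  induction h using Subgroup.closure_induction'' with
  | one => exact ⟨fun _ _ => rfl, fun _ h => h⟩
  | mem x hx =>
    obtain ⟨α, hα, hg⟩ := hx
    exact ⟨P.refl_B hα hg, fun β hβ => by rw [hg]; exact P.refl α hα β hβ⟩
  | inv_mem x hx =>
    obtain ⟨α, hα, hg⟩ := hx
    rw [P.refl_inv hα hg]
    exact ⟨P.refl_B hα hg, fun β hβ => by rw [hg]; exact P.refl α hα β hβ⟩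
  | mul x y _ _ hx hy =>
    exact ⟨fun a b => (hx.1 _ _).trans (hy.1 _ _), fun a ha => hx.2 _ (hy.2 _ ha)⟩

lemma SR_subset : P.SR ⊆ {g | ∃ α ∈ P.Φ, P.IsRefl g α} :=
  fun _ ⟨α, hα, hg⟩ => ⟨α, P.sub hα.1, hg⟩

lemma c_eq {α x : E} (hα : α ∈ P.Φ) : P.c α x = 2 * P.B α x / P.B α α := by
  obtain ⟨q, hq, h⟩ := P.B_pos α hα
  have : P.B α α ≠ 0 := by rw [h]; exact_mod_cast hq.ne'
  rw [eq_div_iff this, P.B_c α hα]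

lemma conj_refl {w g : E ≃ₗ[k] E} (hw : P.Good w) {α : E} (hα : α ∈ P.Φ) (hg : P.IsRefl g α) :
    P.IsRefl (w * g * w⁻¹) (w α) := by
  intro y
  have h1 : P.c α (w⁻¹ y) = P.c (w α) y := by
    rw [P.c_eq hα, P.c_eq (hw.2 α hα), hw.1, ← hw.1 α (w⁻¹ y)]
    congr 3
    exact LinearEquiv.apply_symm_apply w y
  rw [LinearEquiv.mul_apply, LinearEquiv.mul_apply, hg, map_sub, map_smul, h1]
  congr 1
  exact LinearEquiv.apply_symm_apply w y

lemma IsRefl_neg {g : E ≃ₗ[k] E} {α : E} (hα : α ∈ P.Φ) (h : P.IsRefl g (-α)) :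
    P.IsRefl g α := by
  intro y
  rw [h, P.c_eq hα, P.c_eq (P.neg_mem hα)]
  simp only [map_neg, LinearMap.neg_apply, neg_neg, mul_neg, neg_div, smul_neg, neg_smul]

lemma closure_eq :
    Subgroup.closure {g | ∃ α ∈ P.Φ, P.IsRefl g α} = Subgroup.closure P.SR := by
  apply le_antisymm
  · rw [Subgroup.closure_le]
    have key : ∀ β ∈ P.Φp, ∀ g, P.IsRefl g β → g ∈ Subgroup.closure P.SR := by
      intro β hβ g hg
      obtain ⟨w, hw, α, hα, rfl⟩ := P.exists_conj hβ
      obtain ⟨s, hs⟩ := P.exists_refl (P.sub hα.1)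
      have := P.conj_refl (P.good_of_mem (Subgroup.closure_mono P.SR_subset hw)) (P.sub hα.1) hs
      rw [P.refl_ext hg this]
      exact Subgroup.mul_mem _ (Subgroup.mul_mem _ hw (Subgroup.subset_closure ⟨α, hα, hs⟩))
        (Subgroup.inv_mem _ hw)
    rintro g ⟨β, hβ, hg⟩
    rcases P.mem_or hβ with h | h
    · exact key β h g hg
    · exact key _ h g (P.IsRefl_neg (P.neg_mem hβ) (by rwa [neg_neg]))
  · exact Subgroup.closure_mono P.SR_subset

lemma exists_list {w : E ≃ₗ[k] E} (h : w ∈ Subgroup.closure P.SR) :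
    ∃ l : List (E ≃ₗ[k] E), (∀ s ∈ l, s ∈ P.SR) ∧ l.prod = w := by
  rw [← Subgroup.mem_toSubmonoid, Subgroup.closure_toSubmonoid] at h
  obtain ⟨l, hl, h2⟩ := Submonoid.exists_list_of_mem_closure h
  refine ⟨l, fun s hs => ?_, h2⟩
  rcases hl s hs with h | h
  · exact h
  · obtain ⟨α, hα, hg⟩ := h
    have := P.refl_inv (P.sub hα.1) hg
    rw [inv_inv] at this
    rw [this]; exact ⟨α, hα, hg⟩

lemma list_good {l : List (E ≃ₗ[k] E)} (hl : ∀ s ∈ l, s ∈ P.SR) : P.Good l.prod :=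
  P.good_of_mem (Subgroup.list_prod_mem _ fun s hs => Subgroup.subset_closure (P.SR_subset (hl s hs)))

/-- The exchange lemma. -/
lemma exchange {α : E} (hα : P.Simple α) {g : E ≃ₗ[k] E} (hg : P.IsRefl g α) :
    ∀ l : List (E ≃ₗ[k] E), (∀ s ∈ l, s ∈ P.SR) → l.prod α ∉ P.Φp →
      ∃ l' : List (E ≃ₗ[k] E), (∀ s ∈ l', s ∈ P.SR) ∧ l'.length + 1 = l.length ∧
        l.prod * g = l'.prod := by
  intro l
  induction l with
  | nil => intro _ h; exact absurd hα.1 h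
  | cons s l ih =>
    intro hl h
    have hl' : ∀ s ∈ l, s ∈ P.SR := fun s hs => hl s (by simp [hs])
    by_cases h1 : l.prod α ∈ P.Φp
    · obtain ⟨γ, hγ, hs⟩ := hl s (by simp)
      have h2 : l.prod α = γ := by
        by_contra hne
        apply h
        rw [List.prod_cons, LinearEquiv.mul_apply, hs]
        exact P.simple_refl_pos hγ h1 hne
      have h3 := P.conj_refl (P.list_good hl') (P.sub hα.1) hg
      rw [h2] at h3
      have h4 := P.refl_ext h3 hs
      refine ⟨l, hl', by simp, ?_⟩
      have h5 := P.refl_sq (P.sub hγ.1) hs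
      rw [List.prod_cons, mul_assoc]
      have : l.prod * g = s * l.prod := by rw [← h4]; group
      rw [this, ← mul_assoc, h5, one_mul]
    · obtain ⟨l', h2, h3, h4⟩ := ih hl' h1
      obtain hs := hl s (by simp)
      refine ⟨s :: l', ?_, by simp [h3], by rw [List.prod_cons, mul_assoc, h4, List.prod_cons]⟩
      intro x hx
      rcases List.mem_cons.1 hx with rfl | hx
      · exact hs
      · exact h2 x hx

/-- strictly dominant integral -/
def SDom (x : E) : Prop := ∀ α, P.Simple α → ∃ n : ℕ, 0 < n ∧ P.c α x = n

lemma orbit_aux {x : E} (hx : P.SDom x) (n : ℕ) : ∀ l : List (E ≃ₗ[k] E), l.length ≤ n →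
    (∀ s ∈ l, s ∈ P.SR) → x - l.prod x ∈ P.C ∧ (l.prod x = x → l.prod = 1) := by
  induction n with
  | zero =>
    intro l hl _
    have : l = [] := List.length_eq_zero_iff.1 (by omega)
    subst this
    simp
  | succ n ih =>
    intro l hl hS
    rcases List.eq_nil_or_concat l with rfl | ⟨l, s, rfl⟩
    · simp
    rw [List.concat_eq_append] at *
    have hl1 : ∀ s ∈ l, s ∈ P.SR := fun s hs => hS s (by simp [hs])
    obtain ⟨α, hα, hs⟩ := hS s (by simp)
    rw [List.prod_append, List.prod_singleton]
    rw [List.length_append, List.length_singleton] at hl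
    by_cases h1 : l.prod α ∈ P.Φp
    · obtain ⟨m, hm, hmx⟩ := hx α hα
      have h2 := (ih l (by omega) hl1).1
      have h3 : x - (l.prod * s) x = (x - l.prod x) + m • l.prod α := by
        rw [LinearEquiv.mul_apply, hs, map_sub, map_smul, hmx, Nat.cast_smul_eq_nsmul]
        abel
      have h4 : m • l.prod α ∈ P.C := P.C.nsmul_mem (P.mem_C h1) m
      refine ⟨h3 ▸ P.C.add_mem h2 h4, fun h5 => ?_⟩
      exfalso
      rw [h5, sub_self] at h3
      have h6 : m • l.prod α = 0 := P.C_pointed h4 (by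
        have : -(m • l.prod α) = x - l.prod x := by
          rw [neg_eq_iff_add_eq_zero, add_comm]; exact h3.symm
        rwa [this])
      rw [← Nat.cast_smul_eq_nsmul k, smul_eq_zero] at h6
      rcases h6 with h6 | h6
      · exact hm.ne' (by exact_mod_cast h6)
      · exact P.ne_zero (P.sub h1) h6
    · obtain ⟨l', h2, h3, h4⟩ := P.exchange hα hs l hl1 h1
      rw [h4]
      exact ih l' (by omega) h2

lemma orbit {x : E} (hx : P.SDom x) {w : E ≃ₗ[k] E} (hw : w ∈ Subgroup.closure P.SR) :
    x - w x ∈ P.C ∧ (w x = x → w = 1) := by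
  obtain ⟨l, hl, rfl⟩ := P.exists_list hw
  exact P.orbit_aux hx _ l le_rfl hl

lemma det_refl [FiniteDimensional k E] {α : E} (hα : α ∈ P.Φ) {g : E ≃ₗ[k] E}
    (hg : P.IsRefl g α) : LinearMap.det (g : E →ₗ[k] E) = -1 := by
  have : (g : E →ₗ[k] E) = LinearMap.transvection (-(P.c α)) α := by
    ext y
    simp [LinearMap.transvection.apply, hg y, sub_eq_add_neg]
  rw [this, LinearMap.transvection.det]
  simp [P.c_self α hα]
  norm_num

lemma rho_sdom : P.SDom P.rho := fun α hα => ⟨1, one_pos, by simp [P.c_rho hα]⟩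

end PosRS
end WCF

namespace WCF

section GroupAlg
open AddMonoidAlgebra
variable {k E : Type*} [Field k] [CharZero k] [AddCommGroup E] [Module k E]

/-- The linear endomorphism of the group algebra sending `e(μ)` to `φ μ`. -/
noncomputable def lmap (φ : E → AddMonoidAlgebra k E) :
    AddMonoidAlgebra k E →ₗ[k] AddMonoidAlgebra k E :=
  (Finsupp.linearCombination k φ) ∘ₗ (coeffLinearEquiv k).toLinearMap

lemma lmap_single (φ : E → AddMonoidAlgebra k E) (μ : E) (r : k) :
    lmap φ (single μ r) = r • φ μ := by
  simp [lmap]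

/-- The diagonal operator `e(μ) ↦ d(μ) e(μ)`. -/
noncomputable def diag (d : E → k) : AddMonoidAlgebra k E →ₗ[k] AddMonoidAlgebra k E :=
  lmap fun μ => single μ (d μ)

lemma diag_single (d : E → k) (μ : E) (r : k) : diag d (single μ r) = single μ (r * d μ) := by
  simp [diag, lmap_single]

lemma coeff_diag (d : E → k) (f : AddMonoidAlgebra k E) (μ : E) :
    (diag d f).coeff μ = d μ * f.coeff μ := by
  classical
  induction f using AddMonoidAlgebra.induction_linear with
  | zero => simp
  | add x y hx hy => simp [hx, hy, mul_add]
  | single ν r =>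
    rw [diag_single, coeff_single_apply, coeff_single_apply]
    split_ifs with h
    · rw [h, mul_comm]
    · simp

lemma noZeroDiv : NoZeroDivisors (AddMonoidAlgebra k E) := by
  letI : Module ℚ E := Module.compHom E (algebraMap ℚ k)
  infer_instance

/-- Action of a linear automorphism on the group algebra. -/
noncomputable def act (g : E ≃ₗ[k] E) : AddMonoidAlgebra k E ≃+* AddMonoidAlgebra k E :=
  mapDomainRingEquiv k g.toAddEquiv

lemma act_single (g : E ≃ₗ[k] E) (μ : E) (r : k) : act g (single μ r) = single (g μ) r := by
  simp [act]

lemma coeff_act (g : E ≃ₗ[k] E) (f : AddMonoidAlgebra k E) (μ : E) :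
    (act g f).coeff (g μ) = f.coeff μ := by
  rw [act, coeff_mapDomainRingEquiv, Finsupp.equivMapDomain_apply]
  congr 1
  exact LinearEquiv.symm_apply_apply g μ

lemma act_eq {g : E ≃ₗ[k] E} {f : AddMonoidAlgebra k E} {s : k} :
    act g f = s • f ↔ ∀ μ, f.coeff μ = s * f.coeff (g μ) := by
  constructor
  · intro h μ
    rw [← coeff_act g, h]; simp
  · intro h
    ext μ
    obtain ⟨ν, rfl⟩ := g.surjective μ
    rw [coeff_act, h]; simp

namespace PosRS
variable (P : PosRS k E)

/-- `f` has highest term `e(ψ)`. -/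
def HW (f : AddMonoidAlgebra k E) (ψ : E) : Prop :=
  (∀ μ, f.coeff μ ≠ 0 → ψ - μ ∈ P.C) ∧ f.coeff ψ = 1

variable {P}

lemma supp_mul {f g : AddMonoidAlgebra k E} {ψ φ : E} (hf : ∀ μ, f.coeff μ ≠ 0 → ψ - μ ∈ P.C)
    (hg : ∀ μ, g.coeff μ ≠ 0 → φ - μ ∈ P.C) :
    ∀ μ, (f * g).coeff μ ≠ 0 → ψ + φ - μ ∈ P.C := by
  classical
  intro μ h
  rw [coeff_mul] at h
  obtain ⟨a, ha, h⟩ := Finset.exists_ne_zero_of_sum_ne_zero h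
  obtain ⟨b, hb, h⟩ := Finset.exists_ne_zero_of_sum_ne_zero h
  have hab : a + b = μ := by by_contra h'; exact h (if_neg h')
  have h1 := P.C.add_mem (hf a (Finsupp.mem_support_iff.1 ha)) (hg b (Finsupp.mem_support_iff.1 hb))
  rw [← hab]
  convert h1 using 1
  abel

lemma HW.mul {f g : AddMonoidAlgebra k E} {ψ φ : E} (hf : P.HW f ψ) (hg : P.HW g φ) :
    P.HW (f * g) (ψ + φ) := by
  refine ⟨supp_mul hf.1 hg.1, ?_⟩
  rw [coeff_mul_add_of_uniqueAdd, hf.2, hg.2, one_mul]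
  intro a b ha hb hab
  have h1 := hf.1 a (Finsupp.mem_support_iff.1 ha)
  have h2 := hg.1 b (Finsupp.mem_support_iff.1 hb)
  have h3 : ψ - a = -(φ - b) := by
    rw [neg_sub, sub_eq_sub_iff_add_eq_add, ← hab]; abel
  have h4 := P.C_pointed h2 (by rwa [← h3])
  rw [h4, neg_zero] at h3
  exact ⟨(sub_eq_zero.1 h3).symm, (sub_eq_zero.1 h4).symm⟩

lemma HW_single (μ : E) : P.HW (single μ 1) μ := by
  classical
  refine ⟨fun ν h => ?_, by simp⟩
  rw [coeff_single_apply] at h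
  have : μ = ν := by by_contra h'; exact h (if_neg h')
  rw [this, sub_self]; exact P.C.zero_mem

lemma HW_fac {α : E} (hα : α ∈ P.Φp) : P.HW (1 - single (-α) 1) 0 := by
  classical
  have h0 := P.ne_zero (P.sub hα)
  constructor
  · intro ν h
    rw [coeff_sub, Finsupp.sub_apply, coeff_single_apply, AddMonoidAlgebra.one_def,
      coeff_single_apply] at h
    by_cases h1 : 0 = ν
    · rw [h1, sub_self]; exact P.C.zero_mem
    by_cases h2 : -α = ν
    · rw [← h2]; simpa using P.mem_C hα
    · simp [h1, h2] at h
  · rw [coeff_sub, Finsupp.sub_apply, coeff_single_apply, AddMonoidAlgebra.one_def,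
      coeff_single_apply]
    simp [h0]

variable (P)

noncomputable def fac (α : E) : AddMonoidAlgebra k E := 1 - single (-α) 1

/-- The Weyl denominator. -/
noncomputable def delta : AddMonoidAlgebra k E := single P.rho 1 * ∏ α ∈ P.Φp, fac α

lemma HW_delta : P.HW P.delta P.rho := by
  classical
  have : ∀ s ⊆ P.Φp, P.HW (∏ α ∈ s, fac α) 0 := by
    intro s
    induction s using Finset.induction_on with
    | empty => intro _; rw [Finset.prod_empty, AddMonoidAlgebra.one_def]; exact HW_single 0
    | insert a s ha ih =>
      intro h
      rw [Finset.prod_insert ha, ← add_zero (0 : E)]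
      exact (HW_fac (h (Finset.mem_insert_self _ _))).mul
        (ih fun x hx => h (Finset.mem_insert_of_mem hx))
  have := (HW_single (P := P) P.rho).mul (this _ subset_rfl)
  rwa [add_zero] at this

/-- Antisymmetric under the simple reflections. -/
def Anti (F : AddMonoidAlgebra k E) : Prop :=
  ∀ α, P.Simple α → ∀ g, P.IsRefl g α → act g F = -F

lemma Anti.coeff {F : AddMonoidAlgebra k E} (hF : P.Anti F) {α : E} (hα : P.Simple α)
    {g : E ≃ₗ[k] E} (hg : P.IsRefl g α) (μ : E) : F.coeff μ = - F.coeff (g μ) := by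
  have := hF α hα g hg
  rw [← neg_one_smul k, act_eq] at this
  rw [this]; simp

lemma anti_delta : P.Anti P.delta := by
  classical
  intro α hα g hg
  have hgf : ∀ β, act g (fac β) = fac (k := k) (g β) := by
    intro β; simp [fac, act_single]
  have hgα : g α = -α := by
    rw [hg, P.c_self α (P.sub hα.1)]; module
  have h1 : ∏ β ∈ P.Φp, fac (k := k) (g β) = fac (-α) * ∏ β ∈ P.Φp.erase α, fac β := by
    rw [← Finset.mul_prod_erase _ _ hα.1, hgα]
    congr 1
    conv_rhs => rw [← P.simple_image hα hg]
    rw [Finset.prod_image g.injective.injOn]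
  rw [delta, map_mul, map_prod, act_single, P.refl_rho hα hg]
  simp_rw [hgf]
  rw [h1, ← Finset.mul_prod_erase _ _ hα.1, ← mul_assoc, ← mul_assoc, ← neg_mul]
  congr 1
  rw [fac, fac, mul_sub, mul_sub, single_mul_single, single_mul_single]
  simp [sub_eq_add_neg, add_comm]

/-- Uniqueness principle. -/
lemma anti_eq_zero {F : AddMonoidAlgebra k E} (hF : P.Anti F)
    (hFint : ∀ μ, F.coeff μ ≠ 0 → ∀ α, P.Simple α → ∃ n : ℤ, P.c α μ = n)
    (hdom : ∀ μ, F.coeff μ ≠ 0 → ¬ P.SDom μ) : F = 0 := by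
  classical
  by_contra h0
  have hne : F.coeff.support.Nonempty := by
    rw [Finsupp.support_nonempty_iff]; simpa using h0
  obtain ⟨m, hm, hmax⟩ := P.exists_max _ hne
  rw [Finsupp.mem_support_iff] at hm
  apply hdom m hm
  intro α hα
  obtain ⟨n, hn⟩ := hFint m hm α hα
  obtain ⟨g, hg⟩ := P.exists_refl (P.sub hα.1)
  have h1 := hF.coeff P hα hg m
  have h2 : F.coeff (g m) ≠ 0 := by
    intro h; rw [h, neg_zero] at h1; exact hm h1
  have hpos : 0 < n := by
    by_contra hle
    have h3 : g m = m := by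
      apply hmax _ (Finsupp.mem_support_iff.2 h2)
      rw [hg, hn]
      obtain ⟨j, hj⟩ : ∃ j : ℕ, n = -j := ⟨(-n).toNat, by omega⟩
      have : m - (n : k) • α - m = j • α := by
        rw [hj, ← Nat.cast_smul_eq_nsmul k]; push_cast; module
      rw [this]
      exact P.C.nsmul_mem (P.mem_C hα.1) j
    rw [h3] at h1
    exact hm (self_eq_neg.1 h1)
  exact ⟨n.toNat, by omega, by rw [hn]; exact_mod_cast (Int.toNat_of_nonneg hpos.le).symm⟩

end PosRS
end GroupAlg
end WCF

namespace WCF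

section GroupAlg
open AddMonoidAlgebra
variable {k E : Type*} [Field k] [CharZero k] [AddCommGroup E] [Module k E]

/-- The alternating sum over the group `W`. -/
noncomputable def altSum (W : Subgroup (E ≃ₗ[k] E)) [Fintype W] (Λ : E) : AddMonoidAlgebra k E :=
  ∑ w : W, single ((w : E ≃ₗ[k] E) Λ) (LinearMap.det ((w : E ≃ₗ[k] E) : E →ₗ[k] E))

/-- `Γ(f, e(ν)) = ∂_ν f · e(ν)`. -/
noncomputable def gam (B : E →ₗ[k] E →ₗ[k] k) (f : AddMonoidAlgebra k E) :
    AddMonoidAlgebra k E →ₗ[k] AddMonoidAlgebra k E :=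
  lmap fun ν => diag (fun μ => B ν μ) f * single ν 1

variable (B : E →ₗ[k] E →ₗ[k] k)

lemma diag_add_fun (d d' : E → k) (f : AddMonoidAlgebra k E) :
    diag (fun μ => d μ + d' μ) f = diag d f + diag d' f := by
  ext μ; simp [coeff_diag, add_mul]

lemma gam_single (f : AddMonoidAlgebra k E) (ν : E) (r : k) :
    gam B f (single ν r) = diag (fun μ => B ν μ) f * single ν r := by
  rw [gam, lmap_single, ← mul_smul_comm]
  simp

lemma gam_mul (f g h : AddMonoidAlgebra k E) :
    gam B f (g * h) = gam B f g * h + g * gam B f h := by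
  induction g using AddMonoidAlgebra.induction_linear with
  | zero => simp
  | add x y hx hy => rw [add_mul, map_add, hx, hy, map_add]; ring
  | single ν r =>
    induction h using AddMonoidAlgebra.induction_linear with
    | zero => simp
    | add x y hx hy => rw [mul_add, map_add, hx, hy, map_add]; ring
    | single ν' r' =>
      rw [single_mul_single, gam_single, gam_single, gam_single, ← single_mul_single]
      have : (fun μ => B (ν + ν') μ) = fun μ => B ν μ + B ν' μ := by ext; simp
      rw [this, diag_add_fun]; ring

lemma gam_add (f f' g : AddMonoidAlgebra k E) : gam B (f + f') g = gam B f g + gam B f' g := by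
  induction g using AddMonoidAlgebra.induction_linear with
  | zero => simp
  | add x y hx hy => rw [map_add, hx, hy, map_add, map_add]; ring
  | single ν r => simp only [gam_single, map_add, add_mul]

lemma gam_zero (g : AddMonoidAlgebra k E) : gam B 0 g = 0 := by
  have := gam_add B 0 0 g
  rw [add_zero] at this
  simpa using this

lemma diag_mul (hB : ∀ x y, B x y = B y x) (f g : AddMonoidAlgebra k E) :
    diag (fun μ => B μ μ) (f * g) =
      diag (fun μ => B μ μ) f * g + 2 * gam B f g + f * diag (fun μ => B μ μ) g := by
  induction f using AddMonoidAlgebra.induction_linear with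
  | zero => simp [gam_zero]
  | add x y hx hy => rw [add_mul, map_add, hx, hy, map_add, gam_add]; ring
  | single μ r =>
    induction g using AddMonoidAlgebra.induction_linear with
    | zero => simp
    | add x y hx hy => rw [mul_add, map_add, hx, hy, map_add, map_add]; ring
    | single ν s =>
      rw [gam_single, single_mul_single, diag_single, diag_single, diag_single, diag_single,
        single_mul_single, single_mul_single, single_mul_single, two_mul, ← single_add,
        ← single_add, ← single_add]
      congr 1
      simp only [map_add, LinearMap.add_apply]
      rw [hB ν μ]; ring

namespace PosRS
variable (P : PosRS k E)

lemma gam_prod (f : AddMonoidAlgebra k E) (T : E → AddMonoidAlgebra k E) (s : Finset E)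
    (hT : ∀ α ∈ s, T α * fac α = diag (fun μ => P.B α μ) f) :
    gam P.B f (∏ α ∈ s, fac α) = (∑ α ∈ s, T α * single (-α) 1) * ∏ α ∈ s, fac α := by
  classical
  have one : gam P.B f 1 = 0 := by
    rw [AddMonoidAlgebra.one_def, gam_single]
    have : diag (fun μ => P.B 0 μ) f = 0 := by ext; simp [coeff_diag]
    rw [this, zero_mul]
  induction s using Finset.induction_on with
  | empty => simp [one]
  | insert a s ha ih =>
    rw [Finset.prod_insert ha, Finset.sum_insert ha, gam_mul,
      ih fun α hα => hT α (Finset.mem_insert_of_mem hα)]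
    have h1 : gam P.B f (fac a) = T a * single (-a) 1 * fac a := by
      have h2 := hT a (Finset.mem_insert_self _ _)
      have h3 : diag (fun μ => P.B (-a) μ) f = - (T a * fac a) := by
        rw [h2]; ext; simp [coeff_diag]
      conv_lhs => rw [fac]
      rw [map_sub, one, gam_single, h3]
      ring
    rw [h1]; ring

lemma gam_rho (f : AddMonoidAlgebra k E) (T : E → AddMonoidAlgebra k E)
    (hT : ∀ α ∈ P.Φp, T α * fac α = diag (fun μ => P.B α μ) f) :
    2 * gam P.B f (single P.rho 1) = (∑ α ∈ P.Φp, T α * fac α) * single P.rho 1 := by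
  rw [gam_single, ← mul_assoc]
  congr 1
  rw [Finset.sum_congr rfl hT]
  ext μ
  have : (2 : AddMonoidAlgebra k E) * diag (fun μ => P.B P.rho μ) f
    = (2 : k) • diag (fun μ => P.B P.rho μ) f := by
    rw [two_mul, two_smul]
  rw [this, coeff_sum, Finset.sum_apply']
  simp only [coeff_smul, Finsupp.smul_apply, coeff_diag, rho, map_smul, map_sum,
    LinearMap.smul_apply, LinearMap.sum_apply, smul_eq_mul, ← Finset.sum_mul]
  ring

lemma gam_delta (f : AddMonoidAlgebra k E) (T : E → AddMonoidAlgebra k E)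
    (hT : ∀ α ∈ P.Φ, T α * fac α = diag (fun μ => P.B α μ) f) :
    2 * gam P.B f P.delta = (∑ α ∈ P.Φ, T α) * P.delta := by
  classical
  have h1 := P.gam_rho f T fun α h => hT α (P.sub h)
  have h2 := P.gam_prod f T P.Φp fun α h => hT α (P.sub h)
  have hneg : ∀ α ∈ P.Φp, T (-α) = T α * single (-α) 1 := by
    intro α hα
    have e1 := hT α (P.sub hα)
    have e2 := hT (-α) (P.neg_mem (P.sub hα))
    have e3 : diag (fun μ => P.B (-α) μ) f = - diag (fun μ => P.B α μ) f := by
      ext; simp [coeff_diag]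
    rw [e3, ← e1] at e2
    have hee : (single α (1 : k)) * single (-α) (1 : k) = 1 := by
      rw [single_mul_single, add_neg_cancel, one_mul, AddMonoidAlgebra.one_def]
    have e4 : (T (-α) - T α * single (-α) 1) * fac α = 0 := by
      simp only [fac, neg_neg] at e2 ⊢
      linear_combination (-single (-α) (1 : k)) * e2 - T (-α) * hee
    have := noZeroDiv (k := k) (E := E)
    rcases mul_eq_zero.1 e4 with h | h
    · exact sub_eq_zero.1 h
    · exfalso
      have := (HW_fac hα).2
      rw [fac] at h
      rw [h] at this
      simp at this
  have hsplit : ∑ α ∈ P.Φ, T α = ∑ α ∈ P.Φp, (T α + T α * single (-α) 1) := by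
    have hΦ : P.Φ = P.Φp ∪ P.Φp.image (fun x => -x) := by
      ext x
      simp only [Finset.mem_union, Finset.mem_image]
      constructor
      · intro hx
        rcases P.mem_or hx with h | h
        · exact Or.inl h
        · exact Or.inr ⟨-x, h, neg_neg x⟩
      · rintro (h | ⟨y, hy, rfl⟩)
        · exact P.sub h
        · exact P.neg_mem (P.sub hy)
    have hdis : Disjoint P.Φp (P.Φp.image (fun x => -x)) := by
      rw [Finset.disjoint_left]
      intro x hx hx'
      obtain ⟨y, hy, rfl⟩ := Finset.mem_image.1 hx'
      exact P.not_neg hy hx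
    rw [hΦ, Finset.sum_union hdis, Finset.sum_image neg_injective.injOn, Finset.sum_add_distrib,
      Finset.sum_congr rfl hneg]
  have h3 : ∑ α ∈ P.Φp, T α * fac α =
      ∑ α ∈ P.Φp, T α - ∑ α ∈ P.Φp, T α * single (-α) 1 := by
    simp only [fac, mul_sub, mul_one, Finset.sum_sub_distrib]
  rw [hsplit, delta, gam_mul, Finset.sum_add_distrib, h2]
  rw [h3] at h1
  linear_combination h1 * ∏ α ∈ P.Φp, fac α

variable [FiniteDimensional k E] (W : Subgroup (E ≃ₗ[k] E)) [Fintype W]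

lemma anti_altSum (hW : W = Subgroup.closure P.SR) (Λ : E) : P.Anti (altSum W Λ) := by
  intro α hα g hg
  have hgW : g ∈ W := hW ▸ Subgroup.subset_closure ⟨α, hα, hg⟩
  rw [altSum, map_sum, ← Finset.sum_neg_distrib]
  simp_rw [act_single]
  refine Fintype.sum_equiv (Equiv.mulLeft (⟨g, hgW⟩ : W)) _ _ fun w => ?_
  rw [← single_neg]
  have : LinearMap.det ((((⟨g, hgW⟩ : W) * w : W) : E ≃ₗ[k] E) : E →ₗ[k] E)
      = - LinearMap.det ((w : E ≃ₗ[k] E) : E →ₗ[k] E) := by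
    have : ((((⟨g, hgW⟩ : W) * w : W) : E ≃ₗ[k] E) : E →ₗ[k] E)
      = (g : E →ₗ[k] E) * ((w : E ≃ₗ[k] E) : E →ₗ[k] E) := rfl
    rw [this, map_mul, P.det_refl (P.sub hα.1) hg, neg_one_mul]
  rw [Equiv.coe_mulLeft, this, neg_neg]
  rfl

lemma HW_altSum (hW : W = Subgroup.closure P.SR) {Λ : E} (hΛ : P.SDom Λ) :
    P.HW (altSum W Λ) Λ := by
  classical
  have hs : ∀ (w : W) (μ : E), (single ((w : E ≃ₗ[k] E) Λ)
      (LinearMap.det ((w : E ≃ₗ[k] E) : E →ₗ[k] E))).coeff μ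
      = if (w : E ≃ₗ[k] E) Λ = μ then LinearMap.det ((w : E ≃ₗ[k] E) : E →ₗ[k] E) else 0 := by
    intro w μ
    rw [coeff_single, Finsupp.single_apply]
  constructor
  · intro μ h
    rw [altSum, coeff_sum, Finset.sum_apply'] at h
    obtain ⟨w, -, h⟩ := Finset.exists_ne_zero_of_sum_ne_zero h
    rw [hs] at h
    have : (w : E ≃ₗ[k] E) Λ = μ := by by_contra h'; exact h (if_neg h')
    rw [← this]
    exact (P.orbit hΛ (hW ▸ w.2)).1
  · rw [altSum, coeff_sum, Finset.sum_apply', Finset.sum_eq_single 1]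
    · rw [hs]; simp
    · intro w _ hw
      rw [hs, if_neg]
      intro h
      exact hw (Subtype.ext ((P.orbit hΛ (hW ▸ w.2)).2 h))
    · simp

lemma diag_altSum (hW : W = Subgroup.closure P.SR) (Λ : E) :
    diag (fun μ => P.B μ μ) (altSum W Λ) = P.B Λ Λ • altSum W Λ := by
  rw [altSum, map_sum, Finset.smul_sum]
  refine Finset.sum_congr rfl fun w _ => ?_
  rw [diag_single, smul_single]
  have : (w : E ≃ₗ[k] E) ∈ Subgroup.closure P.SR := hW ▸ w.2
  rw [(P.good_of_mem (Subgroup.closure_mono P.SR_subset this)).1, smul_eq_mul, mul_comm]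

lemma delta_eq (hW : W = Subgroup.closure P.SR) : P.delta = altSum W P.rho := by
  rw [← sub_eq_zero]
  have h1 := P.HW_delta
  have h2 := P.HW_altSum W hW P.rho_sdom
  have hsupp : ∀ μ, (P.delta - altSum W P.rho).coeff μ ≠ 0 → P.rho - μ ∈ P.C := by
    intro μ h
    by_contra h'
    apply h
    rw [coeff_sub, Finsupp.sub_apply, not_not.1 fun h => h' (h1.1 μ h),
      not_not.1 fun h => h' (h2.1 μ h), sub_zero]
  apply P.anti_eq_zero
  · intro α hα g hg
    rw [map_sub, P.anti_delta α hα g hg, P.anti_altSum W hW _ α hα g hg]; abel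
  · intro μ h α hα
    obtain ⟨n, hn⟩ := P.int_C (P.sub hα.1) (hsupp μ h)
    refine ⟨1 - n, ?_⟩
    rw [map_sub, P.c_rho hα] at hn
    push_cast; rw [← hn]; ring
  · intro μ h hμ
    have h3 : P.rho - μ = 0 := by
      apply P.eq_zero_of_nonpos (hsupp μ h)
      intro α hα n hn
      obtain ⟨m, hm, hm'⟩ := hμ α hα
      rw [map_sub, P.c_rho hα, hm'] at hn
      have : (1 : ℤ) - m = n := by exact_mod_cast hn
      omega
    rw [sub_eq_zero] at h3
    apply h
    rw [← h3, coeff_sub, Finsupp.sub_apply, h1.2, h2.2, sub_self]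

/-- The Weyl character formula, from the formal properties of the character. -/
theorem formula (hW : W = Subgroup.closure P.SR) (f : AddMonoidAlgebra k E) (ψ : E)
    (hinv : ∀ α, P.Simple α → ∀ g : E ≃ₗ[k] E, P.IsRefl g α → ∀ μ, f.coeff (g μ) = f.coeff μ)
    (hHW : P.HW f ψ) (hdom : ∀ α, P.Simple α → ∃ n : ℕ, P.c α ψ = n)
    (T : E → AddMonoidAlgebra k E)
    (hT : ∀ α ∈ P.Φ, T α * fac α = diag (fun μ => P.B α μ) f)
    (hcas : (P.B ψ ψ + 2 * P.B ψ P.rho) • f = diag (fun μ => P.B μ μ) f + ∑ α ∈ P.Φ, T α) :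
    f * altSum W P.rho = altSum W (ψ + P.rho) := by
  have hΛ : P.SDom (ψ + P.rho) := by
    intro α hα
    obtain ⟨n, hn⟩ := hdom α hα
    exact ⟨n + 1, by omega, by rw [map_add, hn, P.c_rho hα]; push_cast; ring⟩
  have hδ := P.delta_eq W hW
  have h0 : diag (fun μ => P.B μ μ) P.delta = P.B P.rho P.rho • P.delta := by
    rw [hδ, P.diag_altSum W hW]
  have h1 : diag (fun μ => P.B μ μ) (f * P.delta)
      = P.B (ψ + P.rho) (ψ + P.rho) • (f * P.delta) := by
    rw [diag_mul _ P.symm, P.gam_delta f T hT, h0, ← add_mul, ← hcas, mul_smul_comm, smul_mul_assoc,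
      ← add_smul]
    congr 1
    simp only [map_add, LinearMap.add_apply]
    rw [P.symm P.rho ψ]; ring
  rw [← hδ, ← sub_eq_zero]
  have a1 := hHW.mul P.HW_delta
  have a2 := P.HW_altSum W hW hΛ
  have hsupp : ∀ μ, (f * P.delta - altSum W (ψ + P.rho)).coeff μ ≠ 0 →
      ψ + P.rho - μ ∈ P.C := by
    intro μ h
    by_contra h'
    apply h
    rw [coeff_sub, Finsupp.sub_apply, not_not.1 fun h => h' (a1.1 μ h),
      not_not.1 fun h => h' (a2.1 μ h), sub_zero]
  have hB : ∀ μ, (f * P.delta - altSum W (ψ + P.rho)).coeff μ ≠ 0 →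
      P.B μ μ = P.B (ψ + P.rho) (ψ + P.rho) := by
    intro μ h
    have h2 : diag (fun μ => P.B μ μ) (f * P.delta - altSum W (ψ + P.rho)) =
      P.B (ψ + P.rho) (ψ + P.rho) • (f * P.delta - altSum W (ψ + P.rho)) := by
      rw [map_sub, h1, P.diag_altSum W hW, smul_sub]
    have h3 := congrArg (fun F => F.coeff μ) h2
    simp only [coeff_diag, coeff_smul, Finsupp.smul_apply, smul_eq_mul] at h3
    exact mul_right_cancel₀ h h3
  apply P.anti_eq_zero
  · intro α hα g hg
    rw [map_sub, map_mul, P.anti_delta α hα g hg, P.anti_altSum W hW _ α hα g hg]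
    have : act g f = (1 : k) • f := act_eq.2 fun μ => by rw [hinv α hα g hg, one_mul]
    rw [this, one_smul]; ring
  · intro μ h α hα
    obtain ⟨n, hn⟩ := P.int_C (P.sub hα.1) (hsupp μ h)
    obtain ⟨m, -, hm⟩ := hΛ α hα
    refine ⟨m - n, ?_⟩
    rw [map_sub, hm] at hn
    push_cast; rw [← hn]; ring
  · intro μ h hμ
    obtain ⟨s, hs, hsx⟩ := P.exists_simple_multiset (hsupp μ h)
    have key : P.B (ψ + P.rho + μ) (ψ + P.rho - μ) = 0 := by
      have := hB μ h
      generalize ψ + P.rho = x at this ⊢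
      rw [map_sub, map_add, LinearMap.add_apply, LinearMap.add_apply, this, P.symm μ]; ring
    have hs0 : s = 0 := by
      by_contra hne
      obtain ⟨β, hβ⟩ := Multiset.exists_mem_of_ne_zero hne
      obtain ⟨s', rfl⟩ := Multiset.exists_cons_of_mem hβ
      have hpos : ∀ β, P.Simple β → ∃ q : ℚ, 0 < q ∧ P.B (ψ + P.rho + μ) β = q := by
        intro β hβ
        obtain ⟨m, hm, hm'⟩ := hΛ β hβ
        obtain ⟨n, hn, hn'⟩ := hμ β hβ
        obtain ⟨q, hq, h⟩ := P.B_posval (P.sub hβ.1) (x := ψ + P.rho + μ) (n := m + n)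
          (by rw [map_add, hm', hn']; push_cast; ring) (by omega)
        exact ⟨q, hq, by rw [P.symm, h]⟩
      obtain ⟨q, hq, hq'⟩ := hpos β (hs β hβ)
      obtain ⟨r, hr, hr'⟩ := multiset_nonneg (P.B (ψ + P.rho + μ)) s' fun x hx => by
        obtain ⟨q, hq, h⟩ := hpos x (hs x (Multiset.mem_cons_of_mem hx))
        exact ⟨q, hq.le, h⟩
      rw [← hsx, Multiset.sum_cons, map_add, hq', hr'] at key
      have : q + r = 0 := by exact_mod_cast key
      linarith
    rw [hs0, Multiset.sum_zero, eq_comm, sub_eq_zero] at hsx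
    apply h
    rw [← hsx, coeff_sub, Finsupp.sub_apply, a1.2, a2.2, sub_self]

end PosRS
end GroupAlg
end WCF

namespace WCF

section Lie
variable {k : Type*} [Field k] [IsAlgClosed k] [CharZero k]
  {L : Type*} [LieRing L] [LieAlgebra k L] [FiniteDimensional k L] [LieAlgebra.IsKilling k L]
  (H : LieSubalgebra k L) [H.IsCartanSubalgebra] [LieModule.IsTriangularizable k H L]
  (V : Type*) [AddCommGroup V] [Module k V] [LieRingModule L V] [LieModule k L V]
  [FiniteDimensional k V]

/-- Genuine weight spaces. -/
def ws (μ : Module.Dual k H) : Submodule k V where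
  carrier := {v | ∀ h : H, ⁅(h : L), v⁆ = μ h • v}
  add_mem' := by
    intro a b ha hb h
    rw [lie_add, ha, hb, smul_add]
  zero_mem' := by intro h; simp
  smul_mem' := by
    intro c a ha h
    rw [lie_smul, ha, smul_comm]

variable {H V}

lemma mem_ws {μ : Module.Dual k H} {v : V} : v ∈ ws H V μ ↔ ∀ h : H, ⁅(h : L), v⁆ = μ h • v :=
  Iff.rfl

lemma ws_le_gen (μ : Module.Dual k H) :
    ws H V μ ≤ (LieModule.genWeightSpace V (μ : H → k)).toSubmodule := by
  intro v hv
  apply LieModule.weightSpace_le_genWeightSpace V (μ : H → k)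
  rw [LieModule.mem_weightSpace]
  intro h
  exact hv h

lemma lie_root {α : Module.Dual k H} {x : L} (hx : x ∈ rootSpace H (α : H → k)) (h : H) :
    ⁅(h : L), x⁆ = α h • x :=
  LieAlgebra.IsKilling.lie_eq_smul_of_mem_rootSpace hx h

lemma lie_mem_ws {α μ : Module.Dual k H} {x : L} (hx : x ∈ rootSpace H (α : H → k)) {v : V}
    (hv : v ∈ ws H V μ) : ⁅x, v⁆ ∈ ws H V (α + μ) := by
  intro h
  rw [leibniz_lie, lie_root hx, hv h, smul_lie, lie_smul, LinearMap.add_apply, add_smul]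

/-- Induction principle for elements of `L`. -/
lemma L_ind {p : L → Prop} (hH : ∀ h : H, p (h : L))
    (hroot : ∀ α : Module.Dual k H, α ≠ 0 → rootSpace H (α : H → k) ≠ ⊥ →
      ∀ x ∈ rootSpace H (α : H → k), p x)
    (hadd : ∀ x y, p x → p y → p (x + y)) (x : L) : p x := by
  have h0 : p 0 := by simpa using hH 0
  have hx : x ∈ ⨆ χ : LieModule.Weight k H L, genWeightSpace L χ := by
    simp [iSup_genWeightSpace_eq_top' k H L]
  induction hx using LieSubmodule.iSup_induction' with
  | zero => exact h0
  | add x y _ _ hx hy => exact hadd x y hx hy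
  | mem χ x hx =>
    by_cases hχ : χ.IsZero
    · rw [hχ.eq] at hx
      have : x ∈ H := by
        have : x ∈ H.toLieSubmodule := by
          rw [← LieAlgebra.rootSpace_zero_eq k L H]; exact hx
        simpa using this
      exact hH ⟨x, this⟩
    · exact hroot χ.toLinear (by simpa using hχ) χ.genWeightSpace_ne_bot x hx

lemma gen_indep : iSupIndep fun μ : Module.Dual k H =>
    (LieModule.genWeightSpace V (μ : H → k)).toSubmodule := by
  have := (LieModule.iSupIndep_genWeightSpace k H V)
  rw [← LieSubmodule.iSupIndep_toSubmodule] at this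
  exact this.comp (f := fun μ : Module.Dual k H => (μ : H → k)) DFunLike.coe_injective

lemma ws_indep : iSupIndep (ws H V) := gen_indep.mono ws_le_gen

lemma lie_iSup_ws (x : L) {v : V} (hv : v ∈ ⨆ μ, ws H V μ) : ⁅x, v⁆ ∈ ⨆ μ, ws H V μ := by
  induction hv using Submodule.iSup_induction' with
  | zero => simp
  | add a b _ _ ha hb => rw [lie_add]; exact add_mem ha hb
  | mem μ v hv =>
    induction x using L_ind (H := H) with
    | hH h => rw [hv h]; exact Submodule.smul_mem _ _ (Submodule.mem_iSup_of_mem μ hv)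
    | hroot α _ _ x hx => exact Submodule.mem_iSup_of_mem (α + μ) (lie_mem_ws hx hv)
    | hadd x y hx hy => rw [add_lie]; exact add_mem hx hy

lemma submodule_top [LieModule.IsIrreducible k L V] (N : Submodule k V)
    (hN : ∀ (x : L), ∀ v ∈ N, ⁅x, v⁆ ∈ N) {v : V} (hv : v ∈ N) (h0 : v ≠ 0) : N = ⊤ := by
  let N' : LieSubmodule k L V := { N with lie_mem := fun {x v} hv => hN x v hv }
  have : N' = ⊤ := by
    suffices h : Nontrivial N' from LieSubmodule.eq_top_of_isIrreducible k L V N'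
    rw [LieSubmodule.nontrivial_iff_ne_bot]
    intro h
    have : v ∈ N' := hv
    rw [h] at this
    exact h0 (by simpa using this)
  rw [eq_top_iff]
  intro w _
  have : w ∈ N' := by rw [this]; trivial
  exact this

lemma iSup_ws [LieModule.IsIrreducible k L V] [Nontrivial V] : ⨆ μ, ws H V μ = ⊤ := by
  obtain ⟨χ, hχ⟩ := LieModule.exists_nontrivial_weightSpace_of_isNilpotent k H V
  obtain ⟨⟨v, hv⟩, h0⟩ := exists_ne (0 : weightSpace V (χ : H → k))
  refine submodule_top (L := L) _ (fun x v hv => lie_iSup_ws x hv) (v := v)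
    (Submodule.mem_iSup_of_mem χ ?_) ?_
  · rw [LieModule.mem_weightSpace] at hv
    exact hv
  · intro h; apply h0; ext; exact h

lemma gen_eq_ws [LieModule.IsIrreducible k L V] [Nontrivial V] (μ : Module.Dual k H) :
    (LieModule.genWeightSpace V (μ : H → k)).toSubmodule = ws H V μ := by
  apply le_antisymm _ (ws_le_gen μ)
  intro v hv
  have h1 : v ∈ ws H V μ ⊔ ⨆ ν, ⨆ (_ : ν ≠ μ), ws H V ν := by
    have : (⊤ : Submodule k V) ≤ ws H V μ ⊔ ⨆ ν, ⨆ (_ : ν ≠ μ), ws H V ν := by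
      rw [← iSup_ws (H := H) (L := L)]
      apply iSup_le
      intro ν
      by_cases h : ν = μ
      · rw [h]; exact le_sup_left
      · exact le_sup_of_le_right (le_iSup₂_of_le ν h le_rfl)
    exact this trivial
  obtain ⟨a, ha, b, hb, rfl⟩ := Submodule.mem_sup.1 h1
  have h2 : b ∈ (LieModule.genWeightSpace V (μ : H → k)).toSubmodule := by
    have := sub_mem hv (ws_le_gen μ ha)
    simpa using this
  have h3 : b ∈ ⨆ ν, ⨆ (_ : ν ≠ μ), (LieModule.genWeightSpace V (ν : H → k)).toSubmodule :=
    iSup₂_mono (fun ν _ => ws_le_gen ν) hb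
  have h4 : b = 0 := by
    have := Submodule.disjoint_def.1 (gen_indep (H := H) (V := V) (k := k) (L := L) μ) b h2 h3
    exact this
  rw [h4, add_zero]; exact ha

/-- Projections on weight spaces. -/
lemma exists_proj [LieModule.IsIrreducible k L V] [Nontrivial V] (μ : Module.Dual k H) :
    ∃ π : Module.End k V, (∀ v ∈ ws H V μ, π v = v) ∧ (∀ ν, ν ≠ μ → ∀ v ∈ ws H V ν, π v = 0) ∧
      LinearMap.IsProj (ws H V μ) π := by
  have hc : IsCompl (ws H V μ) (⨆ ν, ⨆ (_ : ν ≠ μ), ws H V ν) := by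
    refine ⟨ws_indep μ, ?_⟩
    rw [codisjoint_iff, eq_top_iff, ← iSup_ws (H := H) (L := L)]
    apply iSup_le
    intro ν
    by_cases h : ν = μ
    · rw [h]; exact le_sup_left
    · exact le_sup_of_le_right (le_iSup₂_of_le ν h le_rfl)
  refine ⟨(ws H V μ).subtype ∘ₗ Submodule.linearProjOfIsCompl _ _ hc, ?_, ?_, ?_⟩
  · intro v hv
    exact congrArg Subtype.val (Submodule.linearProjOfIsCompl_apply_left hc ⟨v, hv⟩)
  · intro ν hν v hv
    have : v ∈ ⨆ ν, ⨆ (_ : ν ≠ μ), ws H V ν :=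
      (le_iSup₂_of_le (f := fun ν (_ : ν ≠ μ) => ws H V ν) ν hν le_rfl) hv
    exact congrArg Subtype.val ((Submodule.linearProjOfIsCompl_apply_eq_zero_iff hc).2 this)
  · refine ⟨fun v => by simp, fun v hv => ?_⟩
    exact congrArg Subtype.val (Submodule.linearProjOfIsCompl_apply_left hc ⟨v, hv⟩)

/-- Linear maps agreeing on weight spaces are equal. -/
lemma ext_ws [LieModule.IsIrreducible k L V] [Nontrivial V] {f g : Module.End k V}
    (h : ∀ μ, ∀ v ∈ ws H V μ, f v = g v) : f = g := by
  ext v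
  have hv : v ∈ ⨆ μ, ws H V μ := by rw [iSup_ws]; trivial
  induction hv using Submodule.iSup_induction' with
  | zero => simp
  | add a b _ _ ha hb => rw [map_add, map_add, ha, hb]
  | mem μ v hv => exact h μ v hv

noncomputable def proj [LieModule.IsIrreducible k L V] [Nontrivial V] (μ : Module.Dual k H) :
    Module.End k V := (exists_proj (V := V) μ).choose

section
variable [LieModule.IsIrreducible k L V] [Nontrivial V]

lemma proj_self {μ : Module.Dual k H} {v : V} (hv : v ∈ ws H V μ) : proj μ v = v :=
  (exists_proj (V := V) μ).choose_spec.1 v hv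

lemma proj_ne {μ ν : Module.Dual k H} (h : ν ≠ μ) {v : V} (hv : v ∈ ws H V ν) :
    proj μ v = 0 := (exists_proj (V := V) μ).choose_spec.2.1 ν h v hv

lemma proj_isProj (μ : Module.Dual k H) : LinearMap.IsProj (ws H V μ) (proj (V := V) μ) :=
  (exists_proj (V := V) μ).choose_spec.2.2

lemma trace_proj (μ : Module.Dual k H) :
    LinearMap.trace k V (proj μ) = Module.finrank k (ws H V μ) := (proj_isProj μ).trace

lemma root_proj {α μ : Module.Dual k H} {x : L} (hx : x ∈ rootSpace H (α : H → k)) :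
    toEnd k L V x * proj μ = proj (α + μ) * toEnd k L V x := by
  apply ext_ws (H := H) (L := L)
  intro ν v hv
  simp only [Module.End.mul_apply, toEnd_apply_apply]
  by_cases h : ν = μ
  · subst h
    rw [proj_self hv, proj_self (lie_mem_ws hx hv)]
  · rw [proj_ne h hv, lie_zero, proj_ne _ (lie_mem_ws hx hv)]
    intro h'; exact h (add_left_cancel h')

lemma trace_diff {α μ : Module.Dual k H} {x y : L} (hx : x ∈ rootSpace H (α : H → k))
    {t : H} (ht : ⁅x, y⁆ = (t : L)) :
    LinearMap.trace k V (proj μ * (toEnd k L V x * toEnd k L V y))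
      - LinearMap.trace k V (proj (α + μ) * (toEnd k L V x * toEnd k L V y))
      = μ t * Module.finrank k (ws H V μ) := by
  have h1 : proj (V := V) μ * toEnd k L V (t : L) = μ t • proj μ := by
    apply ext_ws (H := H) (L := L)
    intro ν v hv
    simp only [Module.End.mul_apply, toEnd_apply_apply, LinearMap.smul_apply]
    rw [hv t, map_smul]
    by_cases h : ν = μ
    · rw [h]
    · rw [proj_ne h hv, smul_zero, smul_zero]
  have h2 : toEnd k L V x * toEnd k L V y - toEnd k L V y * toEnd k L V x = toEnd k L V (t : L) := by
    rw [← ht]; ext v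
    simp only [LinearMap.sub_apply, Module.End.mul_apply, toEnd_apply_apply, lie_lie]
  rw [← mul_assoc (proj (α + μ)), ← root_proj hx, mul_assoc,
    LinearMap.trace_mul_comm k (toEnd k L V x), mul_assoc, ← map_sub, ← mul_sub, h2, h1, map_smul,
    trace_proj, smul_eq_mul]

lemma ws_finite : {μ : Module.Dual k H | ws H V μ ≠ ⊥}.Finite :=
  WellFoundedGT.finite_ne_bot_of_iSupIndep ws_indep

end

end Lie
end WCF

namespace WCF

section Lie
variable {k : Type*} [Field k] [IsAlgClosed k] [CharZero k]
  {L : Type*} [LieRing L] [LieAlgebra k L] [FiniteDimensional k L] [LieAlgebra.IsKilling k L]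
  {H : LieSubalgebra k L} [H.IsCartanSubalgebra] [LieModule.IsTriangularizable k H L]
  {V : Type*} [AddCommGroup V] [Module k V] [LieRingModule L V] [LieModule k L V]
  [FiniteDimensional k V]

/-- Words in negative root vectors applied to a highest weight vector. -/
inductive Words (P : PosRS k (Module.Dual k H)) (ψ : Module.Dual k H) (v : V) :
    Module.Dual k H → V → Prop
  | base : Words P ψ v ψ v
  | step (μ α : Module.Dual k H) (u : V) (x : L) (hα : α ∈ P.Φp)
      (hx : x ∈ rootSpace H (-α : Module.Dual k H)) (hu : Words P ψ v μ u) :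
      Words P ψ v (μ - α) ⁅x, u⁆

variable {P : PosRS k (Module.Dual k H)} {ψ : Module.Dual k H} {v : V}

lemma Words.ws (hv : v ∈ ws H V ψ) {μ : Module.Dual k H} {u : V} (h : Words P ψ v μ u) :
    u ∈ WCF.ws H V μ := by
  induction h with
  | base => exact hv
  | step μ α u x hα hx hu ih =>
    rw [sub_eq_neg_add]
    exact lie_mem_ws hx ih

lemma Words.mem {μ : Module.Dual k H} {u : V} (h : Words P ψ v μ u) :
    ψ - μ ∈ P.C ∧ (μ = ψ → u = v) := by
  induction h with
  | base => simp [P.C.zero_mem]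
  | step μ α u x hα hx hu ih =>
    have h1 : ψ - (μ - α) = (ψ - μ) + α := by abel
    refine ⟨h1 ▸ P.C.add_mem ih.1 (P.mem_C hα), fun h2 => ?_⟩
    exfalso
    apply P.pos_not_negC hα
    have : -α = ψ - μ := by rw [← h2]; abel
    rw [this]; exact ih.1

lemma Words.lie_mem (hΦ : ∀ α : Module.Dual k H, α ∈ P.Φ ↔ α ≠ 0 ∧ rootSpace H (α : H → k) ≠ ⊥)
    (hv : v ∈ WCF.ws H V ψ)
    (hkill : ∀ α ∈ P.Φp, ∀ x : L, x ∈ rootSpace H (α : H → k) → ⁅x, v⁆ = 0)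
    {μ : Module.Dual k H} {u : V} (h : Words P ψ v μ u) :
    ∀ y : L, ⁅y, u⁆ ∈ Submodule.span k {u | ∃ μ, Words P ψ v μ u} := by
  have neg_case : ∀ α : Module.Dual k H, -α ∈ P.Φp → ∀ x ∈ rootSpace H (α : H → k),
      ∀ w ∈ Submodule.span k {u | ∃ μ, Words P ψ v μ u},
      ⁅x, w⁆ ∈ Submodule.span k {u | ∃ μ, Words P ψ v μ u} := by
    intro α hα x hx w hw
    induction hw using Submodule.span_induction with
    | mem w hw =>
      obtain ⟨ν, hν⟩ := hw
      refine Submodule.subset_span ⟨_, Words.step ν (-α) w x hα ?_ hν⟩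
      rwa [neg_neg]
    | zero => simp
    | add a b _ _ ha hb => rw [lie_add]; exact add_mem ha hb
    | smul c a _ ha => rw [lie_smul]; exact Submodule.smul_mem _ _ ha
  induction h with
  | base =>
    intro y
    have hb : v ∈ Submodule.span k {u | ∃ μ, Words P ψ v μ u} :=
      Submodule.subset_span ⟨_, Words.base⟩
    induction y using L_ind (H := H) with
    | hH h => rw [hv h]; exact Submodule.smul_mem _ _ hb
    | hroot α h1 h2 x hx =>
      rcases P.mem_or ((hΦ α).2 ⟨h1, h2⟩) with h | h
      · rw [hkill α h x hx]; exact zero_mem _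
      · exact neg_case α h x hx _ hb
    | hadd x y hx hy => rw [add_lie]; exact add_mem hx hy
  | step μ α u x hα hx hu ih =>
    intro y
    have hw : Words P ψ v (μ - α) ⁅x, u⁆ := Words.step μ α u x hα hx hu
    have hb : ⁅x, u⁆ ∈ Submodule.span k {u | ∃ μ, Words P ψ v μ u} :=
      Submodule.subset_span ⟨_, hw⟩
    induction y using L_ind (H := H) with
    | hH h => rw [hw.ws hv h]; exact Submodule.smul_mem _ _ hb
    | hroot β h1 h2 y hy =>
      rcases P.mem_or ((hΦ β).2 ⟨h1, h2⟩) with h | h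
      · rw [leibniz_lie]
        exact add_mem (ih _) (neg_case (-α) (by rwa [neg_neg]) x hx _ (ih y))
      · exact neg_case β h y hy _ hb
    | hadd x y hx hy => rw [add_lie]; exact add_mem hx hy

variable [LieModule.IsIrreducible k L V] [Nontrivial V]

lemma span_words (hΦ : ∀ α : Module.Dual k H, α ∈ P.Φ ↔ α ≠ 0 ∧ rootSpace H (α : H → k) ≠ ⊥)
    (hv : v ∈ WCF.ws H V ψ) (h0 : v ≠ 0)
    (hkill : ∀ α ∈ P.Φp, ∀ x : L, x ∈ rootSpace H (α : H → k) → ⁅x, v⁆ = 0) :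
    Submodule.span k {u | ∃ μ, Words P ψ v μ u} = ⊤ := by
  refine submodule_top (L := L) _ ?_ (Submodule.subset_span ⟨ψ, Words.base⟩) h0
  intro x w hw
  induction hw using Submodule.span_induction with
  | mem w hw =>
    obtain ⟨ν, hν⟩ := hw
    exact hν.lie_mem hΦ hv hkill x
  | zero => simp
  | add a b _ _ ha hb => rw [lie_add]; exact add_mem ha hb
  | smul c a _ ha => rw [lie_smul]; exact Submodule.smul_mem _ _ ha

lemma hw_le (hΦ : ∀ α : Module.Dual k H, α ∈ P.Φ ↔ α ≠ 0 ∧ rootSpace H (α : H → k) ≠ ⊥)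
    (hv : v ∈ WCF.ws H V ψ) (h0 : v ≠ 0)
    (hkill : ∀ α ∈ P.Φp, ∀ x : L, x ∈ rootSpace H (α : H → k) → ⁅x, v⁆ = 0)
    {μ : Module.Dual k H} (hμ : ws H V μ ≠ ⊥) : ψ - μ ∈ P.C := by
  by_contra hc
  apply hμ
  rw [eq_bot_iff]
  intro w hw
  rw [← proj_self hw]
  have : w ∈ Submodule.span k {u | ∃ μ, Words P ψ v μ u} := by
    rw [span_words hΦ hv h0 hkill]; trivial
  clear hw
  induction this using Submodule.span_induction with
  | mem w hw =>
    obtain ⟨ν, hν⟩ := hw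
    rw [proj_ne (ν := ν) _ (hν.ws hv)]
    · simp
    · rintro rfl; exact hc hν.mem.1
  | zero => simp
  | add a b _ _ ha hb => rw [map_add]; exact add_mem ha hb
  | smul c a _ ha => rw [map_smul]; exact Submodule.smul_mem _ _ ha

lemma hw_dim (hΦ : ∀ α : Module.Dual k H, α ∈ P.Φ ↔ α ≠ 0 ∧ rootSpace H (α : H → k) ≠ ⊥)
    (hv : v ∈ WCF.ws H V ψ) (h0 : v ≠ 0)
    (hkill : ∀ α ∈ P.Φp, ∀ x : L, x ∈ rootSpace H (α : H → k) → ⁅x, v⁆ = 0) :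
    Module.finrank k (ws H V ψ) = 1 := by
  have : ws H V ψ = k ∙ v := by
    apply le_antisymm
    · intro w hw
      rw [← proj_self hw]
      have : w ∈ Submodule.span k {u | ∃ μ, Words P ψ v μ u} := by
        rw [span_words hΦ hv h0 hkill]; trivial
      clear hw
      induction this using Submodule.span_induction with
      | mem w hw =>
        obtain ⟨ν, hν⟩ := hw
        by_cases h : ν = ψ
        · have := hν.mem.2 h
          rw [this, proj_self hv]
          exact Submodule.mem_span_singleton_self v
        · rw [proj_ne h (hν.ws hv)]; exact zero_mem _
      | zero => simp
      | add a b _ _ ha hb => rw [map_add]; exact add_mem ha hb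
      | smul c a _ ha => rw [map_smul]; exact Submodule.smul_mem _ _ ha
    · rw [Submodule.span_singleton_le_iff_mem]; exact hv
  rw [this]
  exact finrank_span_singleton h0

end Lie
end WCF

namespace WCF

section Lie
variable {k : Type*} [Field k] [IsAlgClosed k] [CharZero k]
  {L : Type*} [LieRing L] [LieAlgebra k L] [FiniteDimensional k L] [LieAlgebra.IsKilling k L]
  {H : LieSubalgebra k L} [H.IsCartanSubalgebra] [LieModule.IsTriangularizable k H L]
  {V : Type*} [AddCommGroup V] [Module k V] [LieRingModule L V] [LieModule k L V]
  [FiniteDimensional k V]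

lemma kf_lie (x y z : L) : killingForm k L ⁅x, y⁆ z = - killingForm k L y ⁅x, z⁆ := by
  have := LieModule.traceForm_apply_lie_apply k L L y x z
  have h2 : ⁅x, y⁆ = - ⁅y, x⁆ := by rw [lie_skew]
  rw [h2, map_neg, LinearMap.neg_apply]
  exact congrArg _ this

lemma repro_symm {ι : Type*} [Fintype ι] (b b' : ι → L)
    (h : ∀ y, y = ∑ i, killingForm k L y (b' i) • b i) (y : L) :
    y = ∑ i, killingForm k L y (b i) • b' i := by
  have hn := (LieAlgebra.IsKilling.killingForm_nondegenerate k L).1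
  rw [← sub_eq_zero]
  apply hn
  intro z
  rw [map_sub, LinearMap.sub_apply, sub_eq_zero]
  conv_lhs => rw [h z]
  simp only [map_sum, map_smul, LinearMap.sum_apply, LinearMap.smul_apply, smul_eq_mul]
  refine Finset.sum_congr rfl fun i _ => ?_
  rw [mul_comm, LieModule.traceForm_comm k L L z]

lemma casimir_comm {ι : Type*} [Fintype ι] (b b' : ι → L)
    (h : ∀ y, y = ∑ i, killingForm k L y (b' i) • b i) (x : L) :
    toEnd k L V x * (∑ i, toEnd k L V (b i) * toEnd k L V (b' i)) =
      (∑ i, toEnd k L V (b i) * toEnd k L V (b' i)) * toEnd k L V x := by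
  have h' := repro_symm b b' h
  have br : ∀ y : L, toEnd k L V x * toEnd k L V y =
      toEnd k L V ⁅x, y⁆ + toEnd k L V y * toEnd k L V x := by
    intro y; ext v; simp
  rw [Finset.mul_sum, Finset.sum_mul]
  have e1 : ∀ i, toEnd k L V x * (toEnd k L V (b i) * toEnd k L V (b' i)) =
      toEnd k L V ⁅x, b i⁆ * toEnd k L V (b' i) + toEnd k L V (b i) * toEnd k L V ⁅x, b' i⁆
      + toEnd k L V (b i) * toEnd k L V (b' i) * toEnd k L V x := by
    intro i
    rw [← mul_assoc, br, add_mul, mul_assoc, br, mul_add, ← mul_assoc]; abel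
  simp only [e1, Finset.sum_add_distrib]
  rw [add_eq_right]
  have e2 : ∀ i, toEnd k L V ⁅x, b i⁆ * toEnd k L V (b' i) =
      ∑ j, killingForm k L ⁅x, b i⁆ (b' j) • (toEnd k L V (b j) * toEnd k L V (b' i)) := by
    intro i
    conv_lhs => rw [h ⁅x, b i⁆]
    simp [Finset.sum_mul]
  have e3 : ∀ i, toEnd k L V (b i) * toEnd k L V ⁅x, b' i⁆ =
      ∑ j, killingForm k L ⁅x, b' i⁆ (b j) • (toEnd k L V (b i) * toEnd k L V (b' j)) := by
    intro i
    conv_lhs => rw [h' ⁅x, b' i⁆]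
    simp [Finset.mul_sum]
  simp only [e2, e3]
  rw [Finset.sum_comm, ← Finset.sum_add_distrib]
  refine Finset.sum_eq_zero fun i _ => ?_
  rw [← Finset.sum_add_distrib]
  refine Finset.sum_eq_zero fun j _ => ?_
  rw [kf_lie, LieModule.traceForm_comm k L L (b j)]
  simp

lemma toWeight {α : Module.Dual k H} (h0 : α ≠ 0) (h : rootSpace H (α : H → k) ≠ ⊥) :
    ∃ χ : LieModule.Weight k H L, χ.IsNonZero ∧ χ.toLinear = α ∧ (χ : H → k) = α := by
  refine ⟨⟨α, h⟩, ?_, ?_, rfl⟩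
  · intro h'
    apply h0
    ext x
    exact congrFun h' x
  · ext x; rfl

lemma exists_ef {α : Module.Dual k H} (h0 : α ≠ 0) (h : rootSpace H (α : H → k) ≠ ⊥) :
    ∃ e f : L, e ∈ rootSpace H (α : H → k) ∧ f ∈ rootSpace H ((-α : Module.Dual k H) : H → k) ∧
      killingForm k L e f = 1 ∧ ⁅e, f⁆ = (((IsKilling.cartanEquivDual H).symm α : H) : L) ∧
      ∀ x ∈ rootSpace H (α : H → k), ∃ c : k, x = c • e := by
  obtain ⟨χ, hχ, rfl, hχ'⟩ := toWeight h0 h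
  obtain ⟨e, he, he0⟩ := χ.exists_ne_zero
  obtain ⟨f, hf, hef⟩ : ∃ f ∈ rootSpace H (-χ), killingForm k L e f ≠ 0 := by
    contrapose! he0
    simpa using LieAlgebra.mem_ker_killingForm_of_mem_rootSpace_of_forall_rootSpace_neg k L H he he0
  have hef' : ⁅e, (killingForm k L e f)⁻¹ • f⁆ = (((IsKilling.cartanEquivDual H).symm χ.toLinear : H) : L) := by
    rw [lie_smul, LieAlgebra.IsKilling.lie_eq_killingForm_smul_of_mem_rootSpace_of_mem_rootSpace_neg
      he hf, smul_smul, inv_mul_cancel₀ hef, one_smul]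
  refine ⟨e, (killingForm k L e f)⁻¹ • f, he, ?_, ?_, hef', ?_⟩
  · exact Submodule.smul_mem (rootSpace H (-χ)).toSubmodule _ hf
  · rw [map_smul, smul_eq_mul, inv_mul_cancel₀ hef]
  · intro x hx
    have h1 := LieAlgebra.IsKilling.finrank_rootSpace_eq_one χ hχ
    obtain ⟨c, hc⟩ := (finrank_eq_one_iff_of_nonzero' (⟨e, he⟩ : rootSpace H χ)
      (by intro h; apply he0; exact congrArg Subtype.val h)).1 h1 ⟨x, hx⟩
    exact ⟨c, (congrArg Subtype.val hc).symm⟩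

lemma kf_H_root {α : Module.Dual k H} (h0 : α ≠ 0) {x : L} (hx : x ∈ rootSpace H (α : H → k))
    (h : H) : killingForm k L (h : L) x = 0 := by
  have hh : (h : L) ∈ rootSpace H (0 : H → k) := by
    rw [LieAlgebra.rootSpace_zero_eq k L H]; exact h.2
  apply LieAlgebra.killingForm_apply_eq_zero_of_mem_rootSpace_of_add_ne_zero k L H hh hx
  rw [zero_add]; intro h'; apply h0; ext y; exact congrFun h' y

lemma kf_root_ne {α β : Module.Dual k H} (h0 : α ≠ β) {x y : L} (hx : x ∈ rootSpace H (α : H → k))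
    (hy : y ∈ rootSpace H ((-β : Module.Dual k H) : H → k)) : killingForm k L x y = 0 := by
  apply LieAlgebra.killingForm_apply_eq_zero_of_mem_rootSpace_of_add_ne_zero k L H hx hy
  intro h'; apply h0; ext y
  have := congrFun h' y
  simp at this
  linear_combination this

variable [LieModule.IsIrreducible k L V] [Nontrivial V]

/-- Finitely supported function on weights. -/
noncomputable def mk (H : LieSubalgebra k L) [H.IsCartanSubalgebra]
    [LieModule.IsTriangularizable k H L] (V : Type*) [AddCommGroup V] [Module k V]
    [LieRingModule L V] [LieModule k L V] [FiniteDimensional k V]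
    [LieModule.IsIrreducible k L V] [Nontrivial V] (F : Module.Dual k H → k) :
    AddMonoidAlgebra k (Module.Dual k H) :=
  ∑ μ ∈ (ws_finite (H := H) (V := V) (k := k) (L := L)).toFinset, AddMonoidAlgebra.single μ (F μ)

lemma coeff_mk {F : Module.Dual k H → k} (hF : ∀ μ, ws H V μ = ⊥ → F μ = 0) (μ : Module.Dual k H) :
    (mk H V F).coeff μ = F μ := by
  classical
  rw [mk, AddMonoidAlgebra.coeff_sum, Finsupp.finset_sum_apply]
  simp only [AddMonoidAlgebra.coeff_single_apply]
  rw [Finset.sum_ite_eq']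
  split_ifs with h
  · rfl
  · rw [hF]; simpa using h

lemma proj_bot {μ : Module.Dual k H} (h : ws H V μ = ⊥) : proj (V := V) μ = 0 := by
  ext v
  have := (proj_isProj (V := V) μ).map_mem v
  rw [h] at this
  simpa using this

/-- Character. -/
noncomputable def chr (H : LieSubalgebra k L) [H.IsCartanSubalgebra]
    [LieModule.IsTriangularizable k H L] (V : Type*) [AddCommGroup V] [Module k V]
    [LieRingModule L V] [LieModule k L V] [FiniteDimensional k V]
    [LieModule.IsIrreducible k L V] [Nontrivial V] : AddMonoidAlgebra k (Module.Dual k H) :=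
  mk H V fun μ => Module.finrank k (ws H V μ)

lemma coeff_chr (μ : Module.Dual k H) : (chr H V).coeff μ = Module.finrank k (ws H V μ) := by
  rw [chr, coeff_mk]
  intro μ h
  rw [h]; simp

set_option maxHeartbeats 1000000 in
theorem casimir (P : PosRS k (Module.Dual k H))
    (hΦ : ∀ α : Module.Dual k H, α ∈ P.Φ ↔ α ≠ 0 ∧ rootSpace H (α : H → k) ≠ ⊥)
    (hB : ∀ x y, P.B x y = y ((IsKilling.cartanEquivDual H).symm x))
    {ψ : Module.Dual k H} {v : V} (hv : v ∈ ws H V ψ) (h0 : v ≠ 0)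
    (hkill : ∀ α ∈ P.Φp, ∀ x : L, x ∈ rootSpace H (α : H → k) → ⁅x, v⁆ = 0) :
    ∃ T : Module.Dual k H → AddMonoidAlgebra k (Module.Dual k H),
      (∀ α ∈ P.Φ, T α * PosRS.fac α = diag (fun μ => P.B α μ) (chr H V)) ∧
      (P.B ψ ψ + 2 * P.B ψ P.rho) • (chr H V) = diag (fun μ => P.B μ μ) (chr H V) + ∑ α ∈ P.Φ, T α := by
  classical
  have : ∀ α : Module.Dual k H, ∃ e f : L, α ∈ P.Φ →
      (e ∈ rootSpace H (α : H → k) ∧ f ∈ rootSpace H ((-α : Module.Dual k H) : H → k) ∧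
      killingForm k L e f = 1 ∧ ⁅e, f⁆ = (((IsKilling.cartanEquivDual H).symm α : H) : L) ∧
      ∀ x ∈ rootSpace H (α : H → k), ∃ c : k, x = c • e) := by
    intro α
    by_cases h : α ∈ P.Φ
    · obtain ⟨e, f, h1⟩ := exists_ef ((hΦ α).1 h).1 ((hΦ α).1 h).2
      exact ⟨e, f, fun _ => h1⟩
    · exact ⟨0, 0, fun h' => absurd h' h⟩
  choose e f hef using this
  let b := Module.finBasis k H
  let d : Fin (Module.finrank k H) → H := fun i => (IsKilling.cartanEquivDual H).symm (b.coord i)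
  have hd : ∀ (h : H) i, killingForm k L (h : L) (d i : L) = b.coord i h := by
    intro h i
    have h1 : IsKilling.cartanEquivDual H (d i) h = b.coord i h := by
      simp only [d, LinearEquiv.apply_symm_apply]
    rw [LieModule.traceForm_comm, ← h1]
    rfl
  let bb : Fin (Module.finrank k H) ⊕ P.Φ → L := Sum.elim (fun i => (b i : L)) (fun α => e α)
  let dd : Fin (Module.finrank k H) ⊕ P.Φ → L := Sum.elim (fun i => (d i : L)) (fun α => f α)
  have repro : ∀ y, y = ∑ i, killingForm k L y (dd i) • bb i := by
    intro y
    simp only [Fintype.sum_sum_type, bb, dd, Sum.elim_inl, Sum.elim_inr]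
    induction y using L_ind (H := H) with
    | hH h =>
      have : ∑ α : P.Φ, killingForm k L (h : L) (f α) • e α = 0 := by
        refine Finset.sum_eq_zero fun α _ => ?_
        rw [kf_H_root (neg_ne_zero.2 (P.ne_zero α.2)) (hef α α.2).2.1, zero_smul]
      rw [this, add_zero]
      simp only [hd]
      have := congrArg (Subtype.val) (b.sum_repr h)
      rw [AddSubmonoidClass.coe_finset_sum] at this
      exact this.symm
    | hroot β hβ0 hβ y hy =>
      have : ∑ i, killingForm k L y (d i : L) • (b i : L) = 0 := by
        refine Finset.sum_eq_zero fun i _ => ?_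
        rw [LieModule.traceForm_comm]
        have := kf_H_root hβ0 hy (d i)
        rw [this, zero_smul]
      rw [this, zero_add]
      have hβΦ : β ∈ P.Φ := (hΦ β).2 ⟨hβ0, hβ⟩
      rw [Finset.sum_eq_single (⟨β, hβΦ⟩ : P.Φ)]
      · obtain ⟨c, rfl⟩ := (hef β hβΦ).2.2.2.2 y hy
        rw [map_smul, LinearMap.smul_apply, (hef β hβΦ).2.2.1]; simp
      · intro α _ hα
        have hne : β ≠ (α : Module.Dual k H) := by
          intro h; apply hα; exact Subtype.ext h.symm
        have hz : killingForm k L y (f α) = 0 := kf_root_ne hne hy (hef α α.2).2.1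
        rw [hz, zero_smul]
      · intro h; exact absurd (Finset.mem_univ _) h
    | hadd x y hx hy =>
      refine (congrArg₂ (· + ·) hx hy).trans ?_
      simp only [map_add, LinearMap.add_apply, add_smul, Finset.sum_add_distrib]
      abel
  let Ω : Module.End k V := ∑ i, toEnd k L V (bb i) * toEnd k L V (dd i)
  have hcomm : ∀ x : L, toEnd k L V x * Ω = Ω * toEnd k L V x := casimir_comm bb dd repro
  have hΩ : Ω = ∑ i, toEnd k L V (b i : L) * toEnd k L V (d i : L) +
      ∑ α ∈ P.Φ, toEnd k L V (e α) * toEnd k L V (f α) := by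
    simp only [Ω, Fintype.sum_sum_type, bb, dd, Sum.elim_inl, Sum.elim_inr]
    rw [Finset.sum_coe_sort P.Φ (fun α => toEnd k L V (e α) * toEnd k L V (f α))]
  have hHpart : ∀ μ : Module.Dual k H, ∀ w ∈ ws H V μ,
      (∑ i, toEnd k L V (b i : L) * toEnd k L V (d i : L)) w = P.B μ μ • w := by
    intro μ w hw
    have h1 : ∀ i, (toEnd k L V (b i : L) * toEnd k L V (d i : L)) w = (μ (b i) * μ (d i)) • w := by
      intro i
      rw [Module.End.mul_apply, toEnd_apply_apply, toEnd_apply_apply, hw, lie_smul, hw, smul_smul,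
        mul_comm]
    rw [LinearMap.sum_apply, Finset.sum_congr rfl fun i _ => h1 i, ← Finset.sum_smul, hB]
    congr 1
    have h2 : (IsKilling.cartanEquivDual H).symm μ = ∑ i, μ (b i) • d i := by
      rw [LinearEquiv.symm_apply_eq, map_sum]
      simp only [map_smul, d, LinearEquiv.apply_symm_apply]
      exact (b.sum_dual_apply_smul_coord μ).symm
    rw [h2, map_sum]; simp
  have hscal : ∀ w : V, Ω w = (P.B ψ ψ + 2 * P.B ψ P.rho) • w := by
    have hΩv : Ω v = (P.B ψ ψ + 2 * P.B ψ P.rho) • v := by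
      rw [hΩ, LinearMap.add_apply, hHpart ψ v hv, add_smul, LinearMap.sum_apply]
      congr 1
      have h1 : ∀ α ∈ P.Φ, (toEnd k L V (e α) * toEnd k L V (f α)) v =
          if α ∈ P.Φp then P.B ψ α • v else 0 := by
        intro α hα
        rw [Module.End.mul_apply, toEnd_apply_apply, toEnd_apply_apply]
        obtain ⟨h2, h3, -, h4, -⟩ := hef α hα
        split_ifs with h
        · rw [leibniz_lie, hkill α h _ h2, lie_zero, add_zero, h4, hv, P.symm, hB]
        · rw [hkill (-α) ((P.mem_or hα).resolve_left h) _ h3, lie_zero]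
      rw [Finset.sum_congr rfl h1, ← Finset.sum_filter, ← Finset.sum_smul]
      congr 1
      have h5 : P.Φ.filter (· ∈ P.Φp) = P.Φp := by
        ext α; simp only [Finset.mem_filter]; exact ⟨fun h => h.2, fun h => ⟨P.sub h, h⟩⟩
      rw [h5, PosRS.rho, map_smul, map_sum, smul_eq_mul, ← mul_assoc]
      simp
    have := submodule_top (L := L) (LinearMap.ker (Ω - (P.B ψ ψ + 2 * P.B ψ P.rho) • 1)) (v := v)
      (fun x w hw => by
        rw [LinearMap.mem_ker, LinearMap.sub_apply, sub_eq_zero] at hw ⊢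
        have h1 := LinearMap.congr_fun (hcomm x) w
        simp only [Module.End.mul_apply, toEnd_apply_apply] at h1
        rw [← h1, hw]; simp) (by
        rw [LinearMap.mem_ker, LinearMap.sub_apply, sub_eq_zero, hΩv]; simp) h0
    intro w
    have hw : w ∈ (⊤ : Submodule k V) := trivial
    rw [← this, LinearMap.mem_ker, LinearMap.sub_apply, sub_eq_zero] at hw
    rw [hw]; simp
  let T : Module.Dual k H → AddMonoidAlgebra k (Module.Dual k H) := fun α => mk H V fun μ =>
    LinearMap.trace k V (proj μ * (toEnd k L V (e α) * toEnd k L V (f α)))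
  have hTc : ∀ α μ, (T α).coeff μ =
      LinearMap.trace k V (proj μ * (toEnd k L V (e α) * toEnd k L V (f α))) := by
    intro α μ
    rw [coeff_mk]
    intro μ h
    rw [proj_bot h]; simp
  refine ⟨T, ?_, ?_⟩
  · intro α hα
    ext μ
    obtain ⟨h2, h3, -, h4, -⟩ := hef α hα
    have h5 := trace_diff (V := V) (μ := μ) h2 h4
    rw [coeff_diag, coeff_chr, hB, ← h5, PosRS.fac, mul_sub, mul_one, AddMonoidAlgebra.coeff_sub,
      Finsupp.sub_apply, hTc, ← hTc α (α + μ)]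
    congr 1
    have := AddMonoidAlgebra.coeff_mul_single_apply (T α) (1 : k) (-α) μ
    rw [this]
    simp [add_comm]
  · ext μ
    rw [AddMonoidAlgebra.coeff_smul, Finsupp.smul_apply, AddMonoidAlgebra.coeff_add,
      Finsupp.add_apply, coeff_diag, AddMonoidAlgebra.coeff_sum, Finsupp.finset_sum_apply]
    simp only [hTc, coeff_chr]
    have h1 : proj (V := V) μ * Ω = (P.B ψ ψ + 2 * P.B ψ P.rho) • proj μ := by
      ext w
      simp only [Module.End.mul_apply, hscal, map_smul, LinearMap.smul_apply]
    have h2 : proj (V := V) μ * (∑ i, toEnd k L V (b i : L) * toEnd k L V (d i : L)) =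
        P.B μ μ • proj μ := by
      apply ext_ws (H := H) (L := L)
      intro ν w hw
      rw [Module.End.mul_apply, hHpart ν w hw, map_smul, LinearMap.smul_apply]
      by_cases h : ν = μ
      · rw [h]
      · rw [proj_ne h hw, smul_zero, smul_zero]
    rw [← trace_proj, ← map_sum, ← Finset.mul_sum, ← smul_eq_mul (b := LinearMap.trace k V (proj μ)), ← map_smul, ← map_smul, ← h1, ← h2,
       ← map_add, ← mul_add, hΩ]

end Lie
end WCF

namespace WCF

section Exp
lemma exp_intertwine {k A : Type*} [Field k] [CharZero k] [Ring A] [Algebra k A] [Module ℚ A] {a x y z : A} (ha : IsNilpotent a) (h1 : a * x = x * a + y)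
    (h2 : a * y = y * a + z) (h3 : a * z = z * a) :
    IsNilpotent.exp a * x = (x + y + (2 : ℚ)⁻¹ • z) * IsNilpotent.exp a := by
  let l := LinearMap.mulLeft k a
  let r := LinearMap.mulRight k a
  obtain ⟨n, hn⟩ := ha
  have hl : l ^ n = 0 := by
    rw [LinearMap.pow_mulLeft, hn]; ext; simp
  have hr : r ^ n = 0 := by
    rw [LinearMap.pow_mulRight, hn]; ext; simp
  have hlr : Commute l r := LinearMap.commute_mulLeft_right a a
  have hD : IsNilpotent (l - r) := hlr.isNilpotent_sub ⟨n, hl⟩ ⟨n, hr⟩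
  have e1 : IsNilpotent.exp l x = IsNilpotent.exp a * x := by
    rw [IsNilpotent.exp_eq_sum hl, IsNilpotent.exp_eq_sum hn, LinearMap.sum_apply, Finset.sum_mul]
    refine Finset.sum_congr rfl fun i _ => ?_
    rw [LinearMap.smul_apply, LinearMap.pow_mulLeft, LinearMap.mulLeft_apply, smul_mul_assoc]
  have e2 : ∀ w, IsNilpotent.exp r w = w * IsNilpotent.exp a := by
    intro w
    rw [IsNilpotent.exp_eq_sum hr, IsNilpotent.exp_eq_sum hn, LinearMap.sum_apply, Finset.mul_sum]
    refine Finset.sum_congr rfl fun i _ => ?_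
    rw [LinearMap.smul_apply, LinearMap.pow_mulRight, LinearMap.mulRight_apply, mul_smul_comm]
  have e3 : IsNilpotent.exp l = IsNilpotent.exp r * IsNilpotent.exp (l - r) := by
    rw [← IsNilpotent.exp_add_of_commute (hlr.symm.sub_right rfl) ⟨n, hr⟩ hD]
    congr 1; abel
  have d : ∀ w, (l - r) w = a * w - w * a := fun w => rfl
  have d1 : (l - r) x = y := by rw [d, h1]; abel
  have d2 : (l - r) y = z := by rw [d, h2]; abel
  have d3 : (l - r) z = 0 := by rw [d, h3]; abel
  have e4 : IsNilpotent.exp (l - r) x = x + y + (2 : ℚ)⁻¹ • z := by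
    have := IsNilpotent.exp_smul_eq_sum (a := l - r) (m := x) (k := 3) (by
      simp [pow_succ, d1, d2, d3]) hD
    rw [Module.End.smul_def] at this
    rw [this]
    simp [Finset.sum_range_succ, pow_succ, d1, d2]
  rw [← e1, e3, Module.End.mul_apply, e4, e2]

end Exp

section Lie
variable {k : Type*} [Field k] [IsAlgClosed k] [CharZero k]
  {L : Type*} [LieRing L] [LieAlgebra k L] [FiniteDimensional k L] [LieAlgebra.IsKilling k L]
  {H : LieSubalgebra k L} [H.IsCartanSubalgebra] [LieModule.IsTriangularizable k H L]
  {V : Type*} [AddCommGroup V] [Module k V] [LieRingModule L V] [LieModule k L V]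
  [FiniteDimensional k V]

lemma exists_sl2 {α : Module.Dual k H} (h0 : α ≠ 0) (h : rootSpace H (α : H → k) ≠ ⊥) :
    ∃ (χ : LieModule.Weight k H L) (e f : L), χ.IsNonZero ∧ (χ : H → k) = α ∧
      IsSl2Triple ((IsKilling.coroot χ : H) : L) e f ∧ e ∈ rootSpace H (α : H → k) ∧
      f ∈ rootSpace H ((-α : Module.Dual k H) : H → k) := by
  obtain ⟨χ, hχ, rfl, hχ'⟩ := toWeight h0 h
  obtain ⟨t, e, f, hs, he, hf⟩ := LieAlgebra.IsKilling.exists_isSl2Triple_of_weight_isNonZero hχ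
  have := hs.h_eq_coroot hχ he hf
  rw [this] at hs
  exact ⟨χ, e, f, hχ, hχ', hs, he, hf⟩

lemma exists_theta {α : Module.Dual k H} (h0 : α ≠ 0) (h : rootSpace H (α : H → k) ≠ ⊥)
    {c : H} (hc : ∃ χ : LieModule.Weight k H L, (χ : H → k) = α ∧ c = IsKilling.coroot χ) :
    ∃ θ : Module.End k V, IsUnit θ ∧ ∀ x : H, θ * toEnd k L V (x : L) =
      (toEnd k L V (x : L) - α x • toEnd k L V (c : L)) * θ := by
  letI : Module ℚ V := Module.compHom V (algebraMap ℚ k)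
  obtain ⟨χ, e, f, hχ, hχ', hs, he, hf⟩ := exists_sl2 h0 h
  have hc : c = IsKilling.coroot χ := by
    obtain ⟨χ', h1, rfl⟩ := hc
    congr 1; ext y; rw [h1, hχ']
  rw [← hc] at hs
  have he' : IsNilpotent (toEnd k L V e) :=
    LieModule.isNilpotent_toEnd_of_mem_rootSpace (M := V) (H := H) (χ := (α : H → k)) (by
      intro h'; apply h0; ext y; exact congrFun h' y) he
  have hf' : IsNilpotent (toEnd k L V f) :=
    LieModule.isNilpotent_toEnd_of_mem_rootSpace (M := V) (H := H) (χ := ((-α : Module.Dual k H) : H → k)) (by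
      intro h'; apply neg_ne_zero.2 h0; ext y; exact congrFun h' y) hf
  have br : ∀ x y : L, toEnd k L V x * toEnd k L V y =
      toEnd k L V y * toEnd k L V x + toEnd k L V ⁅x, y⁆ := by
    intro x y; ext v; simp
  have hef := hs.lie_e_f
  have hhe := hs.lie_h_e_smul k
  have hhf := hs.lie_lie_smul_f k
  have heh : ⁅e, (c : L)⁆ = -((2 : k) • e) := by rw [← lie_skew, hhe]
  have hfh : ⁅f, (c : L)⁆ = (2 : k) • f := by rw [← lie_skew, hhf, neg_neg]
  have hfe : ⁅f, e⁆ = -(c : L) := by rw [← lie_skew, hef]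
  set E := toEnd k L V e
  set F := toEnd k L V f
  set C := toEnd k L V (c : L)
  have half : ∀ w : Module.End k V, (2 : ℚ)⁻¹ • ((2 : k) • w) = w := by
    intro w
    rw [two_smul, ← two_smul ℚ, smul_smul]; norm_num
  have r1 : ∀ x : H, IsNilpotent.exp E * toEnd k L V (x : L) =
      (toEnd k L V (x : L) - α x • E) * IsNilpotent.exp E := by
    intro x
    have := exp_intertwine (k := k) (a := E) (x := toEnd k L V (x : L)) (y := - (α x • E)) (z := 0) he'
      (by rw [br, ← lie_skew, lie_root he, map_neg, map_smul]) (by simp) (by simp)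
    rw [this]; simp [sub_eq_add_neg]
  have r2 : ∀ x : H, IsNilpotent.exp (-F) * toEnd k L V (x : L) =
      (toEnd k L V (x : L) - α x • F) * IsNilpotent.exp (-F) := by
    intro x
    have := exp_intertwine (k := k) (a := -F) (x := toEnd k L V (x : L)) (y := - (α x • F)) (z := 0)
      hf'.neg
      (by
        rw [neg_mul, br, ← lie_skew, lie_root hf, map_neg, map_smul, LinearMap.neg_apply]
        simp only [neg_smul, neg_neg, mul_neg]; abel) (by simp) (by simp)
    rw [this]; simp [sub_eq_add_neg]
  have r3 : IsNilpotent.exp (-F) * E = (E + C - F) * IsNilpotent.exp (-F) := by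
    have := exp_intertwine (k := k) (a := -F) (x := E) (y := C) (z := - ((2 : k) • F))
      hf'.neg
      (by rw [neg_mul, br, hfe, map_neg]; simp only [mul_neg]; abel)
      (by rw [neg_mul, br, hfh, map_smul]; simp only [mul_neg]; abel) (by simp)
    rw [this, smul_neg, half, sub_eq_add_neg]
  have r4 : IsNilpotent.exp E * C = (C - (2 : k) • E) * IsNilpotent.exp E := by
    rw [r1]
    have : α c = 2 := by
      have h1 := lie_root he c
      rw [hhe] at h1
      exact (smul_left_injective k hs.e_ne_zero h1).symm
    rw [this]
  have r5 : IsNilpotent.exp E * E = E * IsNilpotent.exp E := by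
    have := exp_intertwine (k := k) (a := E) (x := E) (y := 0) (z := 0) he' (by simp) (by simp) (by simp)
    rw [this]; simp
  refine ⟨IsNilpotent.exp E * IsNilpotent.exp (-F) * IsNilpotent.exp E, ?_, ?_⟩
  · exact ((IsNilpotent.isUnit_exp he').mul (IsNilpotent.isUnit_exp hf'.neg)).mul
      (IsNilpotent.isUnit_exp he')
  · intro x
    generalize IsNilpotent.exp E = p at *
    generalize IsNilpotent.exp (-F) = q at *
    have r1 := r1 x
    have r2 := r2 x
    generalize toEnd k L V (x : L) = X at *
    generalize α x = a at *
    calc p * q * p * X = p * q * (p * X) := by simp only [mul_assoc]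
      _ = p * (q * X - a • (q * E)) * p := by
        rw [r1, sub_mul, mul_sub, mul_sub, sub_mul, smul_mul_assoc, mul_smul_comm, mul_smul_comm,
          smul_mul_assoc]
        simp only [mul_assoc]
      _ = (p * X - a • (p * E) - a • (p * C)) * q * p := by
        have e1 : X - a • F - a • (E + C - F) = X - a • E - a • C := by module
        rw [r2, r3, ← smul_mul_assoc, ← sub_mul, ← mul_smul_comm, ← mul_smul_comm, ← mul_sub,
          ← mul_sub, ← mul_assoc, e1]
      _ = (X - a • C) * (p * q * p) := by
        rw [r1, r4, r5, ← smul_mul_assoc, ← smul_mul_assoc, ← sub_mul, ← sub_mul]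
        simp only [mul_assoc]
        have e1 : X - a • E - a • E - a • (C - (2 : k) • E) = X - a • C := by module
        rw [e1]

/-- Invariance of weight multiplicities under reflections. -/
lemma finrank_ws_refl {α : Module.Dual k H} (h0 : α ≠ 0) (h : rootSpace H (α : H → k) ≠ ⊥)
    {c : H} (hc : ∃ χ : LieModule.Weight k H L, (χ : H → k) = α ∧ c = IsKilling.coroot χ)
    (hαc : α c = 2) (μ : Module.Dual k H) :
    Module.finrank k (ws H V (μ - μ c • α)) = Module.finrank k (ws H V μ) := by
  obtain ⟨θ, hθ, hθx⟩ := exists_theta (V := V) h0 h hc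
  have hinj : Function.Injective θ := ((Module.End.isUnit_iff θ).1 hθ).1
  have key : ∀ μ : Module.Dual k H,
      Module.finrank k (ws H V μ) ≤ Module.finrank k (ws H V (μ - μ c • α)) := by
    intro μ
    have hm : ∀ v ∈ ws H V μ, θ v ∈ ws H V (μ - μ c • α) := by
      intro v hv x
      have h1 := LinearMap.congr_fun (hθx (x - α x • c)) v
      have hsub : ((x - α x • c : H) : L) = (x : L) - α x • (c : L) := rfl
      simp only [Module.End.mul_apply, toEnd_apply_apply, hv (x - α x • c), LinearMap.sub_apply,
        LinearMap.smul_apply, map_sub, map_smul, hαc, hsub,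
        sub_lie, smul_lie, smul_eq_mul] at h1
      have h2 : ⁅(x : L), θ v⁆ = (μ x - α x * μ c) • θ v := by
        rw [hv x, hv c, map_smul, map_smul] at h1
        rw [sub_smul, mul_smul, h1]; module
      rw [h2]
      congr 1
      simp [mul_comm]
    exact LinearMap.finrank_le_finrank_of_injective (f := θ.restrict hm) (fun a b hab => by
      apply Subtype.ext; apply hinj; exact congrArg Subtype.val hab)
  apply le_antisymm _ (key μ)
  have := key (μ - μ c • α)
  have e : (μ - μ c • α) - (μ - μ c • α) c • α = μ := by
    simp only [LinearMap.sub_apply, LinearMap.smul_apply, hαc, smul_eq_mul]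
    module
  rwa [e] at this

/-- Dominance of the highest weight. -/
lemma hw_dom {α : Module.Dual k H} (h0 : α ≠ 0) (h : rootSpace H (α : H → k) ≠ ⊥)
    {c : H} (hc : ∃ χ : LieModule.Weight k H L, (χ : H → k) = α ∧ c = IsKilling.coroot χ)
    {ψ : Module.Dual k H} {v : V} (hv : v ∈ ws H V ψ) (hv0 : v ≠ 0)
    (hkill : ∀ x : L, x ∈ rootSpace H (α : H → k) → ⁅x, v⁆ = 0) :
    ∃ n : ℕ, ψ c = n := by
  obtain ⟨χ, e, f, hχ, hχ', hs, he, hf⟩ := exists_sl2 h0 h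
  have hc : c = IsKilling.coroot χ := by
    obtain ⟨χ', h1, rfl⟩ := hc
    congr 1; ext y; rw [h1, hχ']
  rw [← hc] at hs
  have : hs.HasPrimitiveVectorWith v (ψ c) := ⟨hv0, hv c, hkill e he⟩
  exact this.exists_nat

end Lie
end WCF

namespace WCF

section Lie
variable {k : Type*} [Field k] [IsAlgClosed k] [CharZero k]
  {L : Type*} [LieRing L] [LieAlgebra k L] [FiniteDimensional k L] [LieAlgebra.IsKilling k L]
  {H : LieSubalgebra k L} [H.IsCartanSubalgebra] [LieModule.IsTriangularizable k H L]

/-- The form on the dual of the Cartan subalgebra. -/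
noncomputable def KB (H : LieSubalgebra k L) [H.IsCartanSubalgebra]
    [LieModule.IsTriangularizable k H L] : Module.Dual k H →ₗ[k] Module.Dual k H →ₗ[k] k :=
  (Module.Dual.eval k H) ∘ₗ (IsKilling.cartanEquivDual H).symm.toLinearMap

lemma KB_apply (x y : Module.Dual k H) : KB H x y = y ((IsKilling.cartanEquivDual H).symm x) := rfl

lemma ced_sum (a b : H) : IsKilling.cartanEquivDual H a b = ∑ β ∈ H.root, β a * β b := by
  have h1 : IsKilling.cartanEquivDual H a b = (killingForm k L).restrict H a b := rfl
  rw [h1, IsKilling.restrict_killingForm_eq_sum]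
  simp only [LinearMap.sum_apply]
  exact Finset.sum_congr rfl fun _ _ => rfl

lemma KB_eq (x y : Module.Dual k H) : KB H x y =
    ∑ β ∈ H.root, β ((IsKilling.cartanEquivDual H).symm x) * β ((IsKilling.cartanEquivDual H).symm y) := by
  rw [← ced_sum, KB_apply]
  have : y = IsKilling.cartanEquivDual H ((IsKilling.cartanEquivDual H).symm y) := by simp
  conv_lhs => rw [this]
  rw [ced_sum, ced_sum]
  exact Finset.sum_congr rfl fun β _ => mul_comm _ _

lemma KB_symm (x y : Module.Dual k H) : KB H x y = KB H y x := by
  rw [KB_eq, KB_eq]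
  exact Finset.sum_congr rfl fun β _ => mul_comm _ _

lemma KB_coroot {χ : LieModule.Weight k H L} (hχ : χ.IsNonZero) (x : Module.Dual k H) :
    2 * KB H χ.toLinear x = x (IsKilling.coroot χ) * KB H χ.toLinear χ.toLinear := by
  have h := IsKilling.root_apply_cartanEquivDual_symm_ne_zero hχ
  rw [IsKilling.coroot, KB_apply, KB_apply, LieModule.Weight.toLinear_apply, map_nsmul, map_smul]
  simp only [nsmul_eq_mul, smul_eq_mul, Nat.cast_ofNat]
  field_simp

lemma KB_rat {χ : LieModule.Weight k H L} (hχ : χ.IsNonZero) :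
    ∃ q : ℚ, KB H χ.toLinear χ.toLinear = q := by
  have h := IsKilling.root_apply_cartanEquivDual_symm_ne_zero hχ
  have h1 : IsKilling.cartanEquivDual H (IsKilling.coroot χ) (IsKilling.coroot χ) *
      KB H χ.toLinear χ.toLinear = 4 := by
    rw [IsKilling.coroot, KB_apply, map_nsmul, map_nsmul, map_smul, map_smul]
    simp only [LinearMap.smul_apply, nsmul_eq_mul, smul_eq_mul, Nat.cast_ofNat,
      LinearEquiv.apply_symm_apply, LieModule.Weight.toLinear_apply]
    field_simp
    norm_num
  rw [ced_sum] at h1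
  have h2 : ∑ β ∈ H.root, β (IsKilling.coroot χ) * β (IsKilling.coroot χ) =
      ((∑ β ∈ H.root, ((chainBotCoeff χ β : ℤ) - chainTopCoeff χ β : ℤ) ^ 2 : ℤ) : ℚ) := by
    push_cast
    refine Finset.sum_congr rfl fun β _ => ?_
    rw [IsKilling.apply_coroot_eq_cast χ β]
    push_cast; ring
  rw [h2] at h1
  generalize ((∑ β ∈ H.root, ((chainBotCoeff χ β : ℤ) - chainTopCoeff χ β : ℤ) ^ 2 : ℤ) : ℚ) = n at h1
  refine ⟨4 / n, ?_⟩
  have hn : (n : k) ≠ 0 := by intro h; rw [h, zero_mul] at h1; norm_num at h1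
  push_cast
  rw [eq_div_iff hn, mul_comm, h1]

lemma KB_rat2 {χ β : LieModule.Weight k H L} (hχ : χ.IsNonZero) :
    ∃ q : ℚ, KB H χ.toLinear β.toLinear = q := by
  obtain ⟨q, hq⟩ := KB_rat hχ
  have h1 := KB_coroot hχ β.toLinear
  rw [hq, LieModule.Weight.toLinear_apply, IsKilling.apply_coroot_eq_cast χ β] at h1
  refine ⟨2⁻¹ * (((chainBotCoeff χ β : ℤ) - chainTopCoeff χ β : ℤ) * q), ?_⟩
  push_cast at h1 ⊢
  rw [← h1]; ring

lemma KB_definite {Φ : Finset (Module.Dual k H)}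
    (hΦ : ∀ α : Module.Dual k H, α ∈ Φ ↔ α ≠ 0 ∧ rootSpace H (α : H → k) ≠ ⊥)
    (x : Module.Dual k H) (hx : x ∈ AddSubgroup.closure (Φ : Set (Module.Dual k H)))
    (hx0 : x ≠ 0) : ∃ q : ℚ, 0 < q ∧ KB H x x = q := by
  have hr : ∀ β : LieModule.Weight k H L, ∃ q : ℚ,
      β ((IsKilling.cartanEquivDual H).symm x) = q := by
    intro β
    induction hx using AddSubgroup.closure_induction with
    | mem x hx =>
      have hx := (hΦ x).1 hx
      obtain ⟨χ, hχ, rfl, hχ'⟩ := toWeight hx.1 hx.2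
      exact KB_rat2 hχ
    | zero => exact ⟨0, by simp⟩
    | add x y _ _ ihx ihy =>
      by_cases hx0 : x = 0
      · by_cases hy0 : y = 0
        · exact ⟨0, by simp [hx0, hy0]⟩
        · simpa [hx0] using ihy hy0
      by_cases hy0 : y = 0
      · simpa [hy0] using ihx hx0
      obtain ⟨p, hp⟩ := ihx hx0
      obtain ⟨q, hq⟩ := ihy hy0
      refine ⟨p + q, ?_⟩
      rw [← LieModule.Weight.toLinear_apply] at hp hq ⊢
      rw [map_add, map_add, hp, hq]; push_cast; rfl
    | neg x _ ih =>
      obtain ⟨p, hp⟩ := ih (by simpa using hx0)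
      refine ⟨-p, ?_⟩
      rw [← LieModule.Weight.toLinear_apply] at hp ⊢
      rw [map_neg, map_neg, hp]; push_cast; rfl
  choose q hq using hr
  refine ⟨∑ β ∈ H.root, q β ^ 2, ?_, ?_⟩
  · have h0 : 0 ≤ ∑ β ∈ H.root, q β ^ 2 := Finset.sum_nonneg fun β _ => sq_nonneg _
    refine lt_of_le_of_ne h0 fun h => hx0 ?_
    have h1 := (Finset.sum_eq_zero_iff_of_nonneg fun β _ => sq_nonneg (q β)).1 h.symm
    have h2 : IsKilling.cartanEquivDual H ((IsKilling.cartanEquivDual H).symm x) = 0 := by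
      ext b
      rw [ced_sum]
      refine Finset.sum_eq_zero fun β hβ => ?_
      rw [hq, pow_eq_zero_iff (two_ne_zero) |>.1 (h1 β hβ)]; simp
    simpa using h2
  · rw [KB_eq]
    push_cast
    exact Finset.sum_congr rfl fun β _ => by rw [hq]; ring

lemma coroot_unique {Φ : Finset (Module.Dual k H)}
    (hΦ : ∀ α : Module.Dual k H, α ∈ Φ ↔ α ≠ 0 ∧ rootSpace H (α : H → k) ≠ ⊥)
    {χ : LieModule.Weight k H L} (hχ : χ.IsNonZero) {f : Module.Dual k H →ₗ[k] k}
    (hf : f χ.toLinear = 2) (hrefl : ∀ β ∈ Φ, β - f β • χ.toLinear ∈ Φ) (y : Module.Dual k H) :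
    f y = y (IsKilling.coroot χ) := by
  have hspan : Submodule.span k (Φ : Set (Module.Dual k H)) = ⊤ := by
    rw [eq_top_iff, ← IsKilling.span_weight_isNonZero_eq_top k L H]
    apply Submodule.span_mono
    rintro _ ⟨χ, hχ, rfl⟩
    refine (hΦ _).2 ⟨?_, χ.genWeightSpace_ne_bot⟩
    simpa using hχ
  have := Module.Dual.eq_of_preReflection_mapsTo (x := χ.toLinear) Φ.finite_toSet hspan
    (f := f) (g := Module.Dual.eval k H (IsKilling.coroot χ)) hf
    (fun β hβ => hrefl β hβ) (IsKilling.root_apply_coroot hχ) (fun β hβ => by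
      have hβ := (hΦ β).1 hβ
      obtain ⟨β, hβn, rfl, hβ'⟩ := toWeight hβ.1 hβ.2
      have hz := IsKilling.reflectRoot_isNonZero χ β hβn
      have : Module.preReflection χ.toLinear (Module.Dual.eval k H (IsKilling.coroot χ)) β.toLinear =
          (IsKilling.reflectRoot χ β).toLinear := by
        ext x; rfl
      rw [this]
      refine (hΦ _).2 ⟨?_, (IsKilling.reflectRoot χ β).genWeightSpace_ne_bot⟩
      simpa using hz)
  rw [this]; rfl

/-- The root datum attached to the situation of the main theorem. -/
noncomputable def mkP {Φ : Finset (Module.Dual k H)}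
    (hΦ : ∀ α : Module.Dual k H, α ∈ Φ ↔ α ≠ 0 ∧ rootSpace H (α : H → k) ≠ ⊥)
    (coroot : Module.Dual k H → (Module.Dual k H →ₗ[k] k))
    (hcoroot_self : ∀ α ∈ Φ, coroot α α = 2)
    (hcoroot_int : ∀ α ∈ Φ, ∀ β ∈ Φ, ∃ n : ℤ, coroot α β = n)
    (hreflect : ∀ α ∈ Φ, ∀ β ∈ Φ, β - coroot α β • α ∈ Φ)
    {Φpos : Finset (Module.Dual k H)}
    (hpos_subset : Φpos ⊆ Φ)
    (hpos : ∀ α ∈ Φ, (α ∈ Φpos ↔ ¬(-α ∈ Φpos)))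
    (hpos_closed : ∀ α ∈ Φpos, ∀ β ∈ Φpos, α + β ∈ Φ → α + β ∈ Φpos) :
    PosRS k (Module.Dual k H) where
  Φ := Φ
  Φp := Φpos
  B := KB H
  c := coroot
  symm := KB_symm
  B_pos α hα := KB_definite hΦ α (AddSubgroup.subset_closure hα) ((hΦ α).1 hα).1
  B_c := by
    intro α hα x
    have hα' := (hΦ α).1 hα
    obtain ⟨χ, hχ, rfl, hχ'⟩ := toWeight hα'.1 hα'.2
    rw [coroot_unique hΦ hχ (hcoroot_self _ hα) (hreflect _ hα), KB_coroot hχ]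
  int := hcoroot_int
  c_self := hcoroot_self
  refl := hreflect
  definite := KB_definite hΦ
  reduced := by
    intro α hα t ht
    have hα' := (hΦ α).1 hα
    have ht' := (hΦ _).1 ht
    obtain ⟨χ, hχ, rfl, hχ'⟩ := toWeight hα'.1 hα'.2
    obtain ⟨η, hη, hη1, hη'⟩ := toWeight ht'.1 ht'.2
    rcases IsKilling.eq_neg_one_or_eq_zero_or_eq_one_of_eq_smul χ η hχ t hη' with h | h | h
    · exact Or.inr h
    · exfalso; apply ht'.1; rw [h, zero_smul]
    · exact Or.inl h
  string := by
    intro α hα β hβ n hn hneg hne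
    have hα' := (hΦ α).1 hα
    have hβ' := (hΦ β).1 hβ
    obtain ⟨χ, hχ, rfl, hχ'⟩ := toWeight hα'.1 hα'.2
    obtain ⟨η, hη, rfl, hη'⟩ := toWeight hβ'.1 hβ'.2
    rw [coroot_unique hΦ hχ (hcoroot_self _ hα) (hreflect _ hα), LieModule.Weight.toLinear_apply,
      IsKilling.apply_coroot_eq_cast χ η] at hn
    have hn' : ((chainBotCoeff χ η : ℤ) - chainTopCoeff χ η : ℤ) = n := by exact_mod_cast hn
    refine (hΦ _).2 ⟨fun h => hne (eq_neg_of_add_eq_zero_left h), ?_⟩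
    have := (IsKilling.rootSpace_zsmul_add_ne_bot_iff χ η hχ 1).2 ⟨by omega, by omega⟩
    rw [one_smul] at this
    exact this
  sub := hpos_subset
  neg_iff := hpos
  closed := hpos_closed

end Lie
end WCF

namespace WCF

section Sign
variable {k E : Type*} [Field k] [CharZero k] [AddCommGroup E] [Module k E] (P : PosRS k E)

lemma det_list [FiniteDimensional k E] (W : Subgroup (E ≃ₗ[k] E)) (l : List W)
    (hl : ∀ s ∈ l, (s : E ≃ₗ[k] E) ∈ P.SR) :
    LinearMap.det (((l.prod : W) : E ≃ₗ[k] E) : E →ₗ[k] E) = (-1) ^ l.length := by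
  induction l with
  | nil =>
    rw [List.prod_nil, List.length_nil, pow_zero]
    exact map_one (LinearMap.det : (E →ₗ[k] E) →* k)
  | cons a l ih =>
    obtain ⟨α, hα, hg⟩ := hl a (by simp)
    have h1 := P.det_refl (P.sub hα.1) hg
    have h2 := ih fun s hs => hl s (by simp [hs])
    rw [List.prod_cons, List.length_cons, pow_succ', ← h2, ← h1, ← LinearMap.det_comp]
    rfl

lemma sign_eq [FiniteDimensional k E] (W : Subgroup (E ≃ₗ[k] E))
    (hW : W = Subgroup.closure P.SR) (w : W) :
    ((-1 : k)) ^ (wordLength {s : W | (s : E ≃ₗ[k] E) ∈ P.SR} w) =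
      LinearMap.det ((w : E ≃ₗ[k] E) : E →ₗ[k] E) := by
  have hne : {n | ∃ l : List W, (∀ s ∈ l, s ∈ {s : W | (s : E ≃ₗ[k] E) ∈ P.SR}) ∧ l.prod = w ∧
      l.length = n}.Nonempty := by
    have hw : (w : E ≃ₗ[k] E) ∈ Subgroup.closure P.SR := hW ▸ w.2
    obtain ⟨l, hl, h⟩ := P.exists_list hw
    have hl' : ∀ s ∈ l, s ∈ W := fun s hs => by
      rw [hW]; exact Subgroup.subset_closure (hl s hs)
    lift l to List W using hl'
    refine ⟨_, l, fun s hs => hl _ (List.mem_map_of_mem hs), ?_, rfl⟩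
    apply Subtype.ext
    rw [← h]
    exact map_list_prod W.subtype l
  obtain ⟨l, hl, h1, h2⟩ := Nat.sInf_mem hne
  rw [wordLength, ← h2]
  have := det_list P W l hl
  rw [← this, h1]

end Sign

section Transfer
variable {k : Type*} [Field k] [IsAlgClosed k] [CharZero k]
  {L : Type*} [LieRing L] [LieAlgebra k L] [FiniteDimensional k L] [LieAlgebra.IsKilling k L]
  {H : LieSubalgebra k L} [H.IsCartanSubalgebra] [LieModule.IsTriangularizable k H L]
  {V : Type*} [AddCommGroup V] [Module k V] [LieRingModule L V] [LieModule k L V]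
  [FiniteDimensional k V] [Nontrivial V] [LieModule.IsIrreducible k L V]

lemma chr_eq : (chr H V) = ∑ χ : LieModule.Weight k H V,
    AddMonoidAlgebra.single (LieModule.Weight.toLinear k H V χ)
      (Module.finrank k (LieModule.genWeightSpace V (χ : H → k)) : k) := by
  classical
  ext μ
  rw [coeff_chr, AddMonoidAlgebra.coeff_sum, Finsupp.finset_sum_apply]
  simp only [AddMonoidAlgebra.coeff_single_apply]
  by_cases h : LieModule.genWeightSpace V (μ : H → k) = ⊥
  · have h2 : ws H V μ = ⊥ := by rw [← gen_eq_ws, h]; rfl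
    rw [h2, Finset.sum_eq_zero]
    · simp
    · intro χ _
      rw [if_neg]
      rintro rfl
      exact absurd h χ.genWeightSpace_ne_bot
  · rw [Finset.sum_eq_single (⟨(μ : H → k), h⟩ : LieModule.Weight k H V)]
    · rw [if_pos (by ext; rfl), ← gen_eq_ws]
      rfl
    · intro χ _ hne
      rw [if_neg]
      rintro rfl
      exact hne (LieModule.Weight.ext fun _ => rfl)
    · simp

end Transfer
end WCF

/-- **Weyl character formula.**  Let `𝔤` be a finite-dimensional semisimple Lie algebra over an
algebraically closed field `k` of characteristic zero, `𝔥` a splitting Cartan subalgebra, `Φ`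
the set of roots, `Φ⁺` a positive system, `ρ` the half sum of the positive roots and `W` the
Weyl group of `Φ` acting on `𝔥*`, with length function `ℓ`.  If `V` is a nonzero
finite-dimensional irreducible `𝔤`-module with a highest weight vector of weight `ψ` (a nonzero
`v ∈ V_ψ` killed by all the positive root spaces), then in the group algebra `ℤ[𝔥*]` one has
`ch(V) · Σ_{w ∈ W} (-1)^{ℓ(w)} e(w(ρ)) = Σ_{w ∈ W} (-1)^{ℓ(w)} e(w(ψ+ρ))`, where
`ch(V) = Σ_μ dim(V_μ) e(μ)` is the formal character of `V`. -/
theorem weyl_character_formula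
    (k : Type) [Field k] [IsAlgClosed k] [CharZero k]
    (L : Type) [LieRing L] [LieAlgebra k L] [FiniteDimensional k L]
    [LieAlgebra.IsSemisimple k L]
    (H : LieSubalgebra k L) [H.IsCartanSubalgebra] [LieModule.IsTriangularizable k H L]
    (V : Type) [AddCommGroup V] [Module k V] [LieRingModule L V] [LieModule k L V]
    [FiniteDimensional k V] [Nontrivial V] [LieModule.IsIrreducible k L V]
    -- the set `Φ` of roots: the nonzero weights of the adjoint action of `𝔥` on `𝔤`
    (Φ : Finset (Module.Dual k H))
    (hΦ : ∀ α : Module.Dual k H, α ∈ Φ ↔ α ≠ 0 ∧ LieAlgebra.rootSpace H (α : H → k) ≠ ⊥)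
    -- the coroots: `coroot α β = ⟨β, α∨⟩`
    (coroot : Module.Dual k H → (Module.Dual k H →ₗ[k] k))
    (hcoroot_self : ∀ α ∈ Φ, coroot α α = 2)
    (hcoroot_int : ∀ α ∈ Φ, ∀ β ∈ Φ, ∃ n : ℤ, coroot α β = n)
    (hreflect : ∀ α ∈ Φ, ∀ β ∈ Φ, β - coroot α β • α ∈ Φ)
    -- a fixed positive system `Φ⁺ ⊆ Φ`
    (Φpos : Finset (Module.Dual k H))
    (hpos_subset : Φpos ⊆ Φ)
    (hpos : ∀ α ∈ Φ, (α ∈ Φpos ↔ ¬(-α ∈ Φpos)))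
    (hpos_closed : ∀ α ∈ Φpos, ∀ β ∈ Φpos, α + β ∈ Φ → α + β ∈ Φpos)
    -- the Weyl group `W` of `Φ`, acting on `𝔥*`, with its length function `ℓ`
    (W : Subgroup ((Module.Dual k H) ≃ₗ[k] (Module.Dual k H))) [Fintype W]
    (hW : W = Subgroup.closure {g | ∃ α ∈ Φ, ∀ y, g y = y - coroot α y • α})
    (ℓ : W → ℕ)
    (hℓ : ∀ w : W, ℓ w = wordLength
      {s : W | ∃ α ∈ Φpos, (¬ ∃ β ∈ Φpos, ∃ γ ∈ Φpos, α = β + γ) ∧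
        ∀ y, (s : (Module.Dual k H) ≃ₗ[k] (Module.Dual k H)) y = y - coroot α y • α} w)
    -- `ψ` is a highest weight of `V`: some nonzero `v ∈ V_ψ` is killed by the positive
    -- root spaces
    (ψ : Module.Dual k H)
    (hψ : ∃ v ∈ LieModule.genWeightSpace V (ψ : H → k), v ≠ 0 ∧
      ∀ α ∈ Φpos, ∀ x : L, x ∈ LieAlgebra.rootSpace H (α : H → k) → ⁅x, v⁆ = 0) :
    (∑ χ : LieModule.Weight k H V,
        (Module.finrank k (LieModule.genWeightSpace V (χ : H → k)) : ℤ) •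
          AddMonoidAlgebra.single (LieModule.Weight.toLinear k H V χ) (1 : ℤ)) *
      (∑ w : W, ((-1 : ℤ) ^ ℓ w) •
        AddMonoidAlgebra.single
          ((w : (Module.Dual k H) ≃ₗ[k] (Module.Dual k H))
            ((2 : k)⁻¹ • ∑ α ∈ Φpos, α)) (1 : ℤ))
    = ∑ w : W, ((-1 : ℤ) ^ ℓ w) •
        AddMonoidAlgebra.single
          ((w : (Module.Dual k H) ≃ₗ[k] (Module.Dual k H))
            (ψ + (2 : k)⁻¹ • ∑ α ∈ Φpos, α)) (1 : ℤ) := by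
  classical
  have hinj : Function.Injective
      (AddMonoidAlgebra.mapRingHom (Module.Dual k H) (Int.castRingHom k)) :=
    AddMonoidAlgebra.map_injective (f := (Int.castRingHom k : ℤ →+ k)) (Int.cast_injective)
  obtain ⟨v, hv, hv0, hkill⟩ := hψ
  have hv' : v ∈ WCF.ws H V ψ := by rw [← WCF.gen_eq_ws]; exact hv
  let P : WCF.PosRS k (Module.Dual k H) :=
    WCF.mkP hΦ coroot hcoroot_self hcoroot_int hreflect hpos_subset hpos hpos_closed
  have hW' : W = Subgroup.closure P.SR := hW.trans P.closure_eq
  have hco : ∀ α ∈ Φ, ∃ χ : LieModule.Weight k H L, (χ : H → k) = α ∧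
      α (IsKilling.coroot χ) = 2 ∧ ∀ y, coroot α y = y (IsKilling.coroot χ) := by
    intro α hα
    have hα' := (hΦ α).1 hα
    obtain ⟨χ, hχ, rfl, h⟩ := WCF.toWeight hα'.1 hα'.2
    have hu := WCF.coroot_unique hΦ hχ (hcoroot_self _ hα) (hreflect _ hα)
    exact ⟨χ, h, by rw [← hu, hcoroot_self _ hα], hu⟩
  obtain ⟨T, hT, hcas⟩ := WCF.casimir P hΦ (fun _ _ => rfl) hv' hv0 hkill
  have main := P.formula W hW' (WCF.chr H V) ψ (by
      intro α hα g hg μ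
      have hαΦ : α ∈ Φ := P.sub hα.1
      obtain ⟨χ, h1, h2, h3⟩ := hco α hαΦ
      have hg' : g μ = μ - μ (IsKilling.coroot χ) • α := by rw [← h3]; exact hg μ
      rw [hg', WCF.coeff_chr, WCF.coeff_chr,
        WCF.finrank_ws_refl ((hΦ α).1 hαΦ).1 ((hΦ α).1 hαΦ).2 ⟨χ, h1, rfl⟩ h2])
    ⟨fun μ hμ => WCF.hw_le (P := P) hΦ hv' hv0 hkill (fun h => hμ (by rw [WCF.coeff_chr, h]; simp)),
      by rw [WCF.coeff_chr, WCF.hw_dim (P := P) hΦ hv' hv0 hkill, Nat.cast_one]⟩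
    (by
      intro α hα
      have hαΦ : α ∈ Φ := P.sub hα.1
      obtain ⟨χ, h1, h2, h3⟩ := hco α hαΦ
      obtain ⟨n, hn⟩ := WCF.hw_dom ((hΦ α).1 hαΦ).1 ((hΦ α).1 hαΦ).2 ⟨χ, h1, rfl⟩ hv' hv0
        (hkill α hα.1)
      exact ⟨n, (h3 ψ).trans hn⟩)
    T hT hcas
  have hS : {s : W | ∃ α ∈ Φpos, (¬ ∃ β ∈ Φpos, ∃ γ ∈ Φpos, α = β + γ) ∧
        ∀ y, (s : (Module.Dual k H) ≃ₗ[k] (Module.Dual k H)) y = y - coroot α y • α} =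
      {s : W | (s : (Module.Dual k H) ≃ₗ[k] (Module.Dual k H)) ∈ P.SR} := by
    ext s
    exact ⟨fun ⟨α, h1, h2, h3⟩ => ⟨α, ⟨h1, h2⟩, h3⟩, fun ⟨α, ⟨h1, h2⟩, h3⟩ => ⟨α, h1, h2, h3⟩⟩
  have hsgn : ∀ w : W, ((-1 : k)) ^ ℓ w =
      LinearMap.det ((w : (Module.Dual k H) ≃ₗ[k] (Module.Dual k H)) : Module.Dual k H →ₗ[k] _) := by
    intro w
    rw [hℓ, hS, WCF.sign_eq P W hW']
  have halt : ∀ Λ : Module.Dual k H,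
      AddMonoidAlgebra.mapRingHom (Module.Dual k H) (Int.castRingHom k)
        (∑ w : W, ((-1 : ℤ) ^ ℓ w) • AddMonoidAlgebra.single
          ((w : (Module.Dual k H) ≃ₗ[k] (Module.Dual k H)) Λ) (1 : ℤ)) = WCF.altSum W Λ := by
    intro Λ
    rw [map_sum, WCF.altSum]
    refine Finset.sum_congr rfl fun w _ => ?_
    rw [AddMonoidAlgebra.smul_single, AddMonoidAlgebra.mapRingHom_single, ← hsgn]
    simp
  apply hinj
  rw [map_mul, halt, halt]
  have hch : AddMonoidAlgebra.mapRingHom (Module.Dual k H) (Int.castRingHom k)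
      (∑ χ : LieModule.Weight k H V,
        (Module.finrank k (LieModule.genWeightSpace V (χ : H → k)) : ℤ) •
          AddMonoidAlgebra.single (LieModule.Weight.toLinear k H V χ) (1 : ℤ)) =
      WCF.chr H V := by
    rw [map_sum, WCF.chr_eq]
    refine Finset.sum_congr rfl fun χ _ => ?_
    rw [AddMonoidAlgebra.smul_single, AddMonoidAlgebra.mapRingHom_single]
    simp
  rw [hch]
  exact main
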